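/- Let (u₁, u₂) be a C² solution on all of ℝ² of the B₂ Toda system with constant coefficients: Δu₁ + 2e^{u₁} − e^{u₂} = 0 and Δu₂ − 2e^{u₁} + 2e^{u₂} = 0 in ℝ², and assume the finite energy conditions ∫_{ℝ²} e^{u₁} < ∞ and ∫_{ℝ²} e^{u₂} < ∞. Then (1/(2π)) ∫_{ℝ²} e^{u₁} = 6 and (1/(2π)) ∫_{ℝ²} e^{u₂} = 8. -/

import Mathlib

noncomputable section
open Real MeasureTheory Metric Filter Topology

/-- The plane `ℝ²` with the Euclidean metric. -/
abbrev E2 := EuclideanSpace ℝ (Fin 2)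

/-- The Euclidean Laplacian on `ℝ²`: `Δu = ∂²u/∂x₁² + ∂²u/∂x₂²`. -/
noncomputable def lap (u : E2 → ℝ) (x : E2) : ℝ :=
  ∑ i : Fin 2, fderiv ℝ (fun y => fderiv ℝ u y (EuclideanSpace.single i 1)) x
    (EuclideanSpace.single i 1)

namespace TodaB2
open scoped ContDiff

/-- The Wirtinger derivative `∂`. -/
def dz (f : ℂ → ℂ) (z : ℂ) : ℂ := (fderiv ℝ f z 1 - Complex.I * fderiv ℝ f z Complex.I) / 2

/-- The Wirtinger derivative `∂̄`. -/
def dzb (f : ℂ → ℂ) (z : ℂ) : ℂ := (fderiv ℝ f z 1 + Complex.I * fderiv ℝ f z Complex.I) / 2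

theorem fderiv_apply_eq (f : ℂ → ℂ) (z h : ℂ) :
    fderiv ℝ f z h = h.re * fderiv ℝ f z 1 + h.im * fderiv ℝ f z Complex.I := by
  conv_lhs => rw [show h = h.re • (1 : ℂ) + h.im • Complex.I by
    simp [Complex.re_add_im]]
  rw [map_add, map_smul, map_smul]
  simp

theorem dz_add {f g : ℂ → ℂ} {z : ℂ} (hf : DifferentiableAt ℝ f z) (hg : DifferentiableAt ℝ g z) :
    dz (fun w => f w + g w) z = dz f z + dz g z := by
  simp only [dz, fderiv_fun_add hf hg, _root_.add_apply]; ring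

theorem dzb_add {f g : ℂ → ℂ} {z : ℂ} (hf : DifferentiableAt ℝ f z) (hg : DifferentiableAt ℝ g z) :
    dzb (fun w => f w + g w) z = dzb f z + dzb g z := by
  simp only [dzb, fderiv_fun_add hf hg, _root_.add_apply]; ring

theorem dz_sub {f g : ℂ → ℂ} {z : ℂ} (hf : DifferentiableAt ℝ f z) (hg : DifferentiableAt ℝ g z) :
    dz (fun w => f w - g w) z = dz f z - dz g z := by
  simp only [dz, fderiv_fun_sub hf hg, _root_.sub_apply]; ring

theorem dzb_sub {f g : ℂ → ℂ} {z : ℂ} (hf : DifferentiableAt ℝ f z) (hg : DifferentiableAt ℝ g z) :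
    dzb (fun w => f w - g w) z = dzb f z - dzb g z := by
  simp only [dzb, fderiv_fun_sub hf hg, _root_.sub_apply]; ring

theorem dz_mul {f g : ℂ → ℂ} {z : ℂ} (hf : DifferentiableAt ℝ f z) (hg : DifferentiableAt ℝ g z) :
    dz (fun w => f w * g w) z = f z * dz g z + g z * dz f z := by
  simp only [dz, fderiv_fun_mul hf hg, _root_.add_apply,
    _root_.smul_apply, smul_eq_mul]; ring

theorem dzb_mul {f g : ℂ → ℂ} {z : ℂ} (hf : DifferentiableAt ℝ f z) (hg : DifferentiableAt ℝ g z) :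
    dzb (fun w => f w * g w) z = f z * dzb g z + g z * dzb f z := by
  simp only [dzb, fderiv_fun_mul hf hg, _root_.add_apply,
    _root_.smul_apply, smul_eq_mul]; ring

theorem dz_const (c z : ℂ) : dz (fun _ => c) z = 0 := by simp [dz]

theorem dzb_const (c z : ℂ) : dzb (fun _ => c) z = 0 := by simp [dzb]

theorem dz_id (z : ℂ) : dz (fun w => w) z = 1 := by
  simp [dz]

theorem dzb_id (z : ℂ) : dzb (fun w => w) z = 0 := by
  simp [dzb]

theorem differentiableAt_of_dzb_eq_zero {f : ℂ → ℂ} {z : ℂ} (hf : DifferentiableAt ℝ f z)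
    (h : dzb f z = 0) : DifferentiableAt ℂ f z := by
  refine differentiableAt_complex_iff_differentiableAt_real.2 ⟨hf, ?_⟩
  simp only [dzb] at h
  have h2 : fderiv ℝ f z 1 + Complex.I * fderiv ℝ f z Complex.I = 0 := by
    linear_combination 2 * h
  rw [smul_eq_mul]
  linear_combination (-Complex.I) * h2 + (fderiv ℝ f z Complex.I) * Complex.I_mul_I

theorem dz_cexp {f : ℂ → ℂ} {z : ℂ} (hf : DifferentiableAt ℝ f z) :
    dz (fun w => Complex.exp (f w)) z = Complex.exp (f z) * dz f z := by
  have := (hf.hasFDerivAt.cexp).fderiv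
  simp only [dz, this, _root_.smul_apply, smul_eq_mul]; ring

theorem contDiff_fderiv_apply {n m : WithTop ℕ∞} {f : ℂ → ℂ} (hf : ContDiff ℝ n f)
    (hm : m + 1 ≤ n) (v : ℂ) : ContDiff ℝ m (fun z => fderiv ℝ f z v) :=
  (hf.fderiv_right hm).clm_apply contDiff_const

theorem contDiff_dz {n m : WithTop ℕ∞} {f : ℂ → ℂ} (hf : ContDiff ℝ n f) (hm : m + 1 ≤ n) :
    ContDiff ℝ m (dz f) := by
  have h1 := contDiff_fderiv_apply hf hm 1
  have h2 := contDiff_fderiv_apply hf hm Complex.I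
  exact (h1.sub (contDiff_const.mul h2)).div_const 2

theorem contDiff_dzb {n m : WithTop ℕ∞} {f : ℂ → ℂ} (hf : ContDiff ℝ n f) (hm : m + 1 ≤ n) :
    ContDiff ℝ m (dzb f) := by
  have h1 := contDiff_fderiv_apply hf hm 1
  have h2 := contDiff_fderiv_apply hf hm Complex.I
  exact (h1.add (contDiff_const.mul h2)).div_const 2

theorem fderiv_fderiv_apply {f : ℂ → ℂ} (hf : ContDiff ℝ 2 f) (z v w : ℂ) :
    fderiv ℝ (fun y => fderiv ℝ f y v) z w = fderiv ℝ (fderiv ℝ f) z w v := by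
  have hd : DifferentiableAt ℝ (fderiv ℝ f) z :=
    ((hf.fderiv_right (m := 1) (by norm_num)).differentiable (by norm_num)) z
  rw [fderiv_clm_apply hd (by fun_prop)]
  simp

theorem dzb_dz_eq {f : ℂ → ℂ} (hf : ContDiff ℝ 2 f) (z : ℂ) :
    dzb (dz f) z = (fderiv ℝ (fun y => fderiv ℝ f y 1) z 1 +
      fderiv ℝ (fun y => fderiv ℝ f y Complex.I) z Complex.I) / 4 ∧
    dz (dzb f) z = (fderiv ℝ (fun y => fderiv ℝ f y 1) z 1 +
      fderiv ℝ (fun y => fderiv ℝ f y Complex.I) z Complex.I) / 4 := by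
  have h1 : DifferentiableAt ℝ (fun z => fderiv ℝ f z 1) z :=
    (contDiff_fderiv_apply (m := 1) hf (by norm_num) 1).differentiable (by norm_num) z
  have h2 : DifferentiableAt ℝ (fun z => fderiv ℝ f z Complex.I) z :=
    (contDiff_fderiv_apply (m := 1) hf (by norm_num) Complex.I).differentiable (by norm_num) z
  have hsymm : fderiv ℝ (fun y => fderiv ℝ f y Complex.I) z 1 =
      fderiv ℝ (fun y => fderiv ℝ f y 1) z Complex.I := by
    rw [fderiv_fderiv_apply hf, fderiv_fderiv_apply hf]
    exact (hf.contDiffAt.isSymmSndFDerivAt (by simp)).eq _ _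
  have e1 : ∀ v, fderiv ℝ (dz f) z v = (fderiv ℝ (fun y => fderiv ℝ f y 1) z v -
      Complex.I * fderiv ℝ (fun y => fderiv ℝ f y Complex.I) z v) / 2 := by
    intro v
    have := ((h1.hasFDerivAt.sub (h2.hasFDerivAt.const_mul Complex.I)).mul_const (2⁻¹ : ℂ)).fderiv
    have e : dz f = fun y => ((fun z => fderiv ℝ f z 1) -
        fun y => Complex.I * (fun z => fderiv ℝ f z Complex.I) y) y * (2⁻¹ : ℂ) := by
      funext y; simp [dz, div_eq_mul_inv]
    rw [e, this]
    simp [div_eq_mul_inv]; ring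
  have e2 : ∀ v, fderiv ℝ (dzb f) z v = (fderiv ℝ (fun y => fderiv ℝ f y 1) z v +
      Complex.I * fderiv ℝ (fun y => fderiv ℝ f y Complex.I) z v) / 2 := by
    intro v
    have := ((h1.hasFDerivAt.add (h2.hasFDerivAt.const_mul Complex.I)).mul_const (2⁻¹ : ℂ)).fderiv
    have e : dzb f = fun y => ((fun z => fderiv ℝ f z 1) +
        fun y => Complex.I * (fun z => fderiv ℝ f z Complex.I) y) y * (2⁻¹ : ℂ) := by
      funext y; simp [dzb, div_eq_mul_inv]
    rw [e, this]
    simp [div_eq_mul_inv]; ring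
  constructor
  · rw [dzb, e1, e1, hsymm]
    linear_combination (-(fderiv ℝ (fun y => fderiv ℝ f y Complex.I) z Complex.I) / 4) *
        Complex.I_mul_I
  · rw [dz, e2, e2, hsymm]
    linear_combination (-(fderiv ℝ (fun y => fderiv ℝ f y Complex.I) z Complex.I) / 4) *
        Complex.I_mul_I

theorem dzb_dz_comm {f : ℂ → ℂ} (hf : ContDiff ℝ 2 f) (z : ℂ) :
    dzb (dz f) z = dz (dzb f) z := by
  rw [(dzb_dz_eq hf z).1, (dzb_dz_eq hf z).2]

/-- The unit vector at angle `θ`. -/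
def ev (θ : ℝ) : ℂ := Real.cos θ + Real.sin θ * Complex.I

theorem ev_contDiff : ContDiff ℝ ∞ ev := by
  unfold ev
  exact (Complex.ofRealCLM.contDiff.comp Real.contDiff_cos).add
    ((Complex.ofRealCLM.contDiff.comp Real.contDiff_sin).mul contDiff_const)

@[fun_prop]
theorem ev_continuous : Continuous ev := ev_contDiff.continuous

theorem ev_eq (θ : ℝ) : ev θ = Complex.exp (θ * Complex.I) := by
  simp [ev, Complex.exp_mul_I]

theorem ev_hasDerivAt (θ : ℝ) : HasDerivAt ev (Complex.I * ev θ) θ := by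
  have h1 := (Real.hasDerivAt_cos θ).ofReal_comp
  have h2 := ((Real.hasDerivAt_sin θ).ofReal_comp).mul_const Complex.I
  refine (h1.add h2).congr_deriv ?_
  simp only [ev]
  push_cast
  linear_combination (-Complex.sin θ) * Complex.I_mul_I

theorem norm_ev (θ : ℝ) : ‖ev θ‖ = 1 := by
  rw [ev_eq, Complex.norm_exp_ofReal_mul_I]

theorem ev_pi : ev π = ev (-π) := by simp [ev]

theorem integral_ball_polar {E : Type*} [NormedAddCommGroup E] [NormedSpace ℝ E]
    {K : ℝ → ℝ → E} (hK : Continuous (Function.uncurry K)) {f : ℂ → E} {R : ℝ} (hR : 0 ≤ R)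
    (h : ∀ r, 0 < r → r < R → ∀ θ, r • f (r * ev θ) = K r θ) :
    ∫ z in ball (0 : ℂ) R, f z = ∫ r in (0 : ℝ)..R, ∫ θ in (-π)..π, K r θ := by
  rw [← integral_indicator measurableSet_ball, ← Complex.integral_comp_polarCoord_symm]
  have e1 : ∫ p in polarCoord.target, p.1 • (ball (0 : ℂ) R).indicator f (Complex.polarCoord.symm p)
      = ∫ p in polarCoord.target, (Set.Ioo 0 R ×ˢ Set.Ioo (-π) π).indicator
        (Function.uncurry K) p := by
    refine setIntegral_congr_fun polarCoord.open_target.measurableSet ?_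
    rintro ⟨r, θ⟩ hp
    simp only [polarCoord_target, Set.mem_prod, Set.mem_Ioi] at hp
    have hn : ‖Complex.polarCoord.symm (r, θ)‖ = r := by
      rw [Complex.norm_polarCoord_symm, abs_of_pos hp.1]
    by_cases hr : r < R
    · have h2 : Complex.polarCoord.symm (r, θ) ∈ ball (0 : ℂ) R := by
        rw [mem_ball_zero_iff, hn]; exact hr
      simp only
      rw [Set.indicator_of_mem h2, Set.indicator_of_mem (by simp [hp.1, hr]; exact hp.2)]
      simpa [ev] using h r hp.1 hr θ
    · have h2 : Complex.polarCoord.symm (r, θ) ∉ ball (0 : ℂ) R := by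
        rw [mem_ball_zero_iff, hn]; exact hr
      simp only
      rw [Set.indicator_of_notMem h2, Set.indicator_of_notMem (by simp [hr]), smul_zero]
  rw [e1, polarCoord_target, setIntegral_indicator (measurableSet_Ioo.prod measurableSet_Ioo)]
  have e2 : (Set.Ioi (0:ℝ) ×ˢ Set.Ioo (-π) π) ∩ (Set.Ioo 0 R ×ˢ Set.Ioo (-π) π)
      = Set.Ioo 0 R ×ˢ Set.Ioo (-π) π := by
    rw [Set.inter_eq_right]
    exact Set.prod_mono (fun x hx => hx.1) le_rfl
  rw [e2]
  have hint : IntegrableOn (Function.uncurry K) (Set.Ioo 0 R ×ˢ Set.Ioo (-π) π)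
      ((volume : Measure ℝ).prod volume) := by
    refine IntegrableOn.mono_set (t := Set.Icc 0 R ×ˢ Set.Icc (-π) π) ?_
      (Set.prod_mono Set.Ioo_subset_Icc_self Set.Ioo_subset_Icc_self)
    exact hK.continuousOn.integrableOn_compact (isCompact_Icc.prod isCompact_Icc)
  rw [Measure.volume_eq_prod, setIntegral_prod _ hint, intervalIntegral.integral_of_le hR,
    ← integral_Ioc_eq_integral_Ioo]
  refine integral_congr_ae (Eventually.of_forall fun r => ?_)
  simp only
  rw [intervalIntegral.integral_of_le (by linarith [Real.pi_pos]), ← integral_Ioc_eq_integral_Ioo]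
  rfl

theorem integral_inv_norm_ball {R : ℝ} (hR : 0 ≤ R) :
    ∫ z in ball (0 : ℂ) R, ‖z‖⁻¹ = 2 * π * R := by
  rw [integral_ball_polar (K := fun _ _ => (1 : ℝ)) continuous_const hR]
  · simp; ring
  · intro r hr _ θ
    rw [norm_mul, norm_ev, mul_one, Complex.norm_real, Real.norm_eq_abs, abs_of_pos hr,
      smul_eq_mul, mul_inv_cancel₀ hr.ne']

theorem locallyIntegrable_inv : LocallyIntegrable (fun z : ℂ => z⁻¹) := by
  refine locallyIntegrable_of_norm_le_rpow (by simp) (C := 1) (α := 1) (by simp) ?_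
    (measurable_inv.aestronglyMeasurable)
  exact Eventually.of_forall fun z => by simp [Real.rpow_neg_one]

theorem hasDerivAt_radial {E : Type*} [NormedAddCommGroup E] [NormedSpace ℝ E] {h : ℂ → E}
    {r θ : ℝ} (hh : DifferentiableAt ℝ h (r * ev θ)) :
    HasDerivAt (fun s : ℝ => h (s * ev θ)) (fderiv ℝ h (r * ev θ) (ev θ)) r := by
  have h1 : HasDerivAt (fun s : ℝ => (s : ℂ) * ev θ) (ev θ) r := by
    simpa using (Complex.ofRealCLM.hasDerivAt (x := r)).mul_const (ev θ)
  exact hh.hasFDerivAt.comp_hasDerivAt r h1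

theorem hasDerivAt_angular {E : Type*} [NormedAddCommGroup E] [NormedSpace ℝ E] {h : ℂ → E}
    {r θ : ℝ} (hh : DifferentiableAt ℝ h (r * ev θ)) :
    HasDerivAt (fun t : ℝ => h (r * ev t)) (r • fderiv ℝ h (r * ev θ) (Complex.I * ev θ)) θ := by
  have h1 : HasDerivAt (fun t : ℝ => (r : ℂ) * ev t) (r • (Complex.I * ev θ)) θ := by
    simpa using (ev_hasDerivAt θ).const_mul (r : ℂ)
  rw [← map_smul]
  exact hh.hasFDerivAt.comp_hasDerivAt θ h1

/-- The Cauchy–Pompeiu formula for compactly supported functions. -/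
theorem integral_dzb_mul_inv {h : ℂ → ℂ} (hh : ContDiff ℝ 1 h) (hc : HasCompactSupport h) :
    ∫ z, z⁻¹ * dzb h z = -π * h 0 := by
  obtain ⟨R, hR, hsub⟩ := hc.isBounded.subset_ball_lt 0 0
  have hzero : ∀ z, z ∉ ball (0 : ℂ) R → h z = 0 := fun z hz =>
    image_eq_zero_of_notMem_tsupport fun h' => hz (hsub h')
  have hfz : ∀ z, z ∉ ball (0 : ℂ) R → fderiv ℝ h z = 0 := fun z hz =>
    image_eq_zero_of_notMem_tsupport fun h' => hz (hsub (tsupport_fderiv_subset ℝ h'))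
  have hcont : Continuous (fderiv ℝ h) := hh.continuous_fderiv one_ne_zero
  have hdiff : Differentiable ℝ h := hh.differentiable one_ne_zero
  have e0 : ∫ z, z⁻¹ * dzb h z = ∫ z in ball (0 : ℂ) R, z⁻¹ * dzb h z := by
    refine (setIntegral_eq_integral_of_forall_compl_eq_zero fun z hz => ?_).symm
    simp [dzb, hfz z hz]
  let K1 : ℝ → ℝ → ℂ := fun r θ => fderiv ℝ h (r * ev θ) (ev θ)
  let K2 : ℝ → ℝ → ℂ := fun r θ => fderiv ℝ h (r * ev θ) (Complex.I * ev θ)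
  have hev : Continuous fun p : ℝ × ℝ => ev p.2 := ev_continuous.comp continuous_snd
  have hpt : Continuous fun p : ℝ × ℝ => (p.1 : ℂ) * ev p.2 :=
    (Complex.continuous_ofReal.comp continuous_fst).mul hev
  have hK1 : Continuous (Function.uncurry K1) := (hcont.comp hpt).clm_apply hev
  have hK2 : Continuous (Function.uncurry K2) :=
    (hcont.comp hpt).clm_apply (continuous_const.mul hev)
  rw [e0, integral_ball_polar (K := fun r θ => (1 / 2 : ℂ) * (K1 r θ + Complex.I * K2 r θ))
    (by exact continuous_const.mul (hK1.add (continuous_const.mul hK2))) hR.le]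
  · have c1 : ∀ r, Continuous (K1 r) := fun r => hK1.comp (by fun_prop : Continuous fun θ => (r, θ))
    have c2 : ∀ r, Continuous (K2 r) := fun r => hK2.comp (by fun_prop : Continuous fun θ => (r, θ))
    have i2 : ∀ r, 0 < r → ∫ θ in (-π)..π, K2 r θ = 0 := by
      intro r hr
      have := intervalIntegral.integral_eq_sub_of_hasDerivAt (a := -π) (b := π)
        (fun θ _ => hasDerivAt_angular (r := r) (θ := θ) (hdiff _))
        ((continuous_const.smul (c2 r)).intervalIntegrable _ _)
      rw [ev_pi, sub_self, intervalIntegral.integral_smul] at this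
      exact (smul_eq_zero.1 this).resolve_left hr.ne'
    have i1 : ∫ r in (0:ℝ)..R, ∫ θ in (-π)..π, K1 r θ = -(2 * π) * h 0 := by
      rw [intervalIntegral_intervalIntegral_swap]
      · have : ∀ θ, ∫ r in (0:ℝ)..R, K1 r θ = - h 0 := by
          intro θ
          rw [intervalIntegral.integral_eq_sub_of_hasDerivAt (a := 0) (b := R)
            (fun r _ => hasDerivAt_radial (r := r) (θ := θ) (hdiff _))
            ((hK1.comp (by fun_prop : Continuous fun r => (r, θ))).intervalIntegrable _ _)]
          rw [hzero (R * ev θ) (by simp [norm_ev, abs_of_pos hR])]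
          simp
        simp_rw [this]
        simp only [intervalIntegral.integral_const, Complex.real_smul]
        push_cast; ring
      · exact (hK1.continuousOn.integrableOn_compact
          (isCompact_uIcc.prod isCompact_uIcc)).mono_set
          (Set.prod_mono Set.uIoc_subset_uIcc Set.uIoc_subset_uIcc)
    have e2 : ∫ r in (0:ℝ)..R, ∫ θ in (-π)..π, (1 / 2 : ℂ) * (K1 r θ + Complex.I * K2 r θ)
        = ∫ r in (0:ℝ)..R, (1 / 2 : ℂ) * ∫ θ in (-π)..π, K1 r θ := by
      refine intervalIntegral.integral_congr_ae (Eventually.of_forall fun r hr => ?_)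
      rw [Set.uIoc_of_le hR.le] at hr
      have hI2 : IntervalIntegrable (fun θ => Complex.I * K2 r θ) volume (-π) π :=
        (continuous_const.mul (c2 r)).intervalIntegrable _ _
      rw [intervalIntegral.integral_const_mul, intervalIntegral.integral_add
        ((c1 r).intervalIntegrable _ _) hI2,
        intervalIntegral.integral_const_mul, i2 r hr.1]
      simp
    rw [e2, intervalIntegral.integral_const_mul, i1]
    ring
  · intro r hr _ θ
    have hrc : (r : ℂ) ≠ 0 := by exact_mod_cast hr.ne'
    have hsq : ((Real.cos θ : ℂ))^2 + (Real.sin θ : ℂ)^2 = 1 := by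
      exact_mod_cast Real.cos_sq_add_sin_sq θ
    simp only [K1, K2]
    rw [fderiv_apply_eq h _ (ev θ), fderiv_apply_eq h _ (Complex.I * ev θ), dzb, Complex.real_smul]
    have hre : (ev θ).re = Real.cos θ := by simp [ev, Complex.cos_ofReal_re]
    have him : (ev θ).im = Real.sin θ := by simp [ev, Complex.sin_ofReal_re]
    have hinv : (ev θ)⁻¹ = Real.cos θ - Real.sin θ * Complex.I := by
      refine inv_eq_of_mul_eq_one_right ?_
      rw [ev]
      linear_combination hsq - (Real.sin θ : ℂ) ^ 2 * Complex.I_mul_I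
    rw [Complex.I_mul_re, Complex.I_mul_im, hre, him, mul_inv, hinv]
    set x := fderiv ℝ h (r * ev θ) 1
    set y := fderiv ℝ h (r * ev θ) Complex.I
    have hr1 : (r : ℂ) * (r : ℂ)⁻¹ = 1 := mul_inv_cancel₀ hrc
    push_cast
    linear_combination (Complex.cos θ - Complex.sin θ * Complex.I) * (x + Complex.I * y) / 2 * hr1
      - Complex.sin θ * y / 2 * Complex.I_mul_I

/-- The Cauchy transform. -/
def cauchyT (h : ℂ → ℂ) (z : ℂ) : ℂ := (π : ℂ)⁻¹ * ∫ t, t⁻¹ * h (z - t)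

theorem cauchyT_eq (h : ℂ → ℂ) :
    cauchyT h = fun z => (π : ℂ)⁻¹ *
      convolution (fun t : ℂ => t⁻¹) h (ContinuousLinearMap.mul ℝ ℂ) volume z := by
  funext z
  simp [cauchyT, convolution]

theorem cauchyT_contDiff {n : ℕ∞} {h : ℂ → ℂ} (hh : ContDiff ℝ n h) (hc : HasCompactSupport h) :
    ContDiff ℝ n (cauchyT h) := by
  rw [cauchyT_eq]
  exact contDiff_const.mul (hc.contDiff_convolution_right _ locallyIntegrable_inv hh)

theorem dzb_comp_const_sub {h : ℂ → ℂ} (hh : Differentiable ℝ h) (z t : ℂ) :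
    dzb (fun s => h (z - s)) t = - dzb h (z - t) := by
  have : fderiv ℝ (fun s => h (z - s)) t = _ :=
    ((hh (z - t)).hasFDerivAt.comp t ((hasFDerivAt_id t).const_sub z)).fderiv
  simp only [dzb]
  rw [this]
  simp; ring

theorem dzb_cauchyT {h : ℂ → ℂ} (hh : ContDiff ℝ 1 h) (hc : HasCompactSupport h) (z : ℂ) :
    dzb (cauchyT h) z = h z := by
  have hd := hc.hasFDerivAt_convolution_right (ContinuousLinearMap.mul ℝ ℂ) locallyIntegrable_inv
    hh z
  have hd' : ∀ v, fderiv ℝ (cauchyT h) z v = (π : ℂ)⁻¹ * ∫ t, t⁻¹ * fderiv ℝ h (z - t) v := by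
    intro v
    rw [cauchyT_eq, (hd.const_mul _).fderiv, _root_.smul_apply, convolution_precompR_apply _
      locallyIntegrable_inv (hc.fderiv ℝ) (hh.continuous_fderiv one_ne_zero)]
    simp [convolution]
  have hint : ∀ v, Integrable fun t => t⁻¹ * fderiv ℝ h (z - t) v := by
    intro v
    have := (hc.fderiv_apply ℝ v).convolutionExists_right (ContinuousLinearMap.mul ℝ ℂ)
      locallyIntegrable_inv ((hh.continuous_fderiv one_ne_zero).clm_apply continuous_const) z
    simpa [ConvolutionExistsAt] using this
  have hcp := integral_dzb_mul_inv (h := fun t => h (z - t))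
    (hh.comp (contDiff_const.sub contDiff_id))
    (hc.comp_homeomorph (Homeomorph.subLeft z))
  simp only [dzb_comp_const_sub (hh.differentiable one_ne_zero), mul_neg, integral_neg,
    sub_zero] at hcp
  rw [dzb, hd', hd', mul_left_comm, ← mul_add, ← integral_const_mul, ← integral_add (hint 1)
    ((hint _).const_mul _)]
  have e : (fun t => t⁻¹ * fderiv ℝ h (z - t) 1 + Complex.I * (t⁻¹ * fderiv ℝ h (z - t) Complex.I))
      = fun t => 2 * (t⁻¹ * dzb h (z - t)) := by
    funext t; simp only [dzb]; ring
  have hpi : (π : ℂ) ≠ 0 := by exact_mod_cast Real.pi_ne_zero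
  rw [e, integral_const_mul]
  rw [neg_inj.1 (hcp.trans (neg_mul _ _))]
  field_simp

/-- Interior regularity for the `∂̄`-equation. -/
theorem contDiff_of_dzb {n : ℕ∞} (hn : 1 ≤ n) {p : ℂ → ℂ} (hp : ContDiff ℝ 1 p)
    (hg : ContDiff ℝ n (dzb p)) : ContDiff ℝ n p := by
  rw [contDiff_iff_contDiffAt]
  intro z
  let χ : ContDiffBump z := ⟨1, 2, one_pos, one_lt_two⟩
  let h : ℂ → ℂ := fun w => (χ w : ℂ) * dzb p w
  have hχ : ContDiff ℝ n fun w => (χ w : ℂ) := Complex.ofRealCLM.contDiff.comp χ.contDiff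
  have hh : ContDiff ℝ n h := hχ.mul hg
  have hc : HasCompactSupport h :=
    (χ.hasCompactSupport.comp_left (g := fun x : ℝ => (x : ℂ)) (by simp)).mul_right
  have h1n : (1 : WithTop ℕ∞) ≤ n := by exact_mod_cast hn
  have hT := cauchyT_contDiff hh hc
  have hhol : DifferentiableOn ℂ (fun w => p w - cauchyT h w) (ball z 1) := by
    intro w hw
    have d1 := (hp.differentiable one_ne_zero) w
    have d2 := ((hT.of_le h1n).differentiable one_ne_zero) w
    refine (differentiableAt_of_dzb_eq_zero (f := fun w => p w - cauchyT h w)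
      (d1.sub d2) ?_).differentiableWithinAt
    rw [dzb_sub d1 d2, dzb_cauchyT (hh.of_le h1n) hc]
    simp only [h]
    rw [χ.one_of_mem_closedBall (ball_subset_closedBall hw)]
    simp
  have h2 : ContDiffAt ℝ n (fun w => p w - cauchyT h w) z :=
    ((hhol.contDiffOn isOpen_ball).contDiffAt (ball_mem_nhds z one_pos)).restrict_scalars ℝ
  have := h2.add hT.contDiffAt
  simpa using this

/-- The Laplacian of a real function on `ℂ`. -/
def lapC (v : ℂ → ℝ) (z : ℂ) : ℝ :=
  fderiv ℝ (fun w => fderiv ℝ v w 1) z 1 + fderiv ℝ (fun w => fderiv ℝ v w Complex.I) z Complex.I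

theorem lapC_eq {v : ℂ → ℝ} (hv : ContDiff ℝ 2 v) (z : ℂ) :
    lapC v z = fderiv ℝ (fderiv ℝ v) z 1 1 + fderiv ℝ (fderiv ℝ v) z Complex.I Complex.I := by
  have hd : DifferentiableAt ℝ (fderiv ℝ v) z :=
    ((hv.fderiv_right (m := 1) (by norm_num)).differentiable (by norm_num)) z
  rw [lapC, fderiv_clm_apply hd (by fun_prop), fderiv_clm_apply hd (by fun_prop)]
  simp

theorem continuous_lapC {v : ℂ → ℝ} (hv : ContDiff ℝ 2 v) : Continuous (lapC v) := by
  have h1 : ContDiff ℝ 1 (fderiv ℝ v) := hv.fderiv_right (by norm_num)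
  have h2 : Continuous (fderiv ℝ (fderiv ℝ v)) := h1.continuous_fderiv one_ne_zero
  rw [funext (lapC_eq hv)]
  exact ((h2.clm_apply continuous_const).clm_apply continuous_const).add
    ((h2.clm_apply continuous_const).clm_apply continuous_const)

theorem bilin_rotate (B : ℂ →L[ℝ] ℂ →L[ℝ] ℝ) (θ : ℝ) :
    B (ev θ) (ev θ) + B (Complex.I * ev θ) (Complex.I * ev θ) =
      B 1 1 + B Complex.I Complex.I := by
  have h1 : ev θ = Real.cos θ • (1 : ℂ) + Real.sin θ • Complex.I := by simp [ev]
  have h2 : Complex.I * ev θ = (-Real.sin θ) • (1 : ℂ) + Real.cos θ • Complex.I := by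
    simp only [ev, Complex.real_smul]; push_cast
    linear_combination Complex.sin θ * Complex.I_mul_I
  rw [h2, h1]
  simp only [map_add, map_smul, _root_.add_apply, _root_.smul_apply, smul_eq_mul]
  linear_combination (B 1 1 + B Complex.I Complex.I) * Real.cos_sq_add_sin_sq θ

theorem integral_swap_of_continuous {K : ℝ → ℝ → ℝ} (hK : Continuous (Function.uncurry K))
    (a b c d : ℝ) :
    ∫ x in a..b, ∫ y in c..d, K x y = ∫ y in c..d, ∫ x in a..b, K x y :=
  intervalIntegral_intervalIntegral_swap <|
    (hK.continuousOn.integrableOn_compact (isCompact_uIcc.prod isCompact_uIcc)).mono_set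
      (Set.prod_mono Set.uIoc_subset_uIcc Set.uIoc_subset_uIcc)

/-- Mean value inequality for subharmonic functions. -/
theorem sub_mean_value_zero {G : ℂ → ℝ} (hG : ContDiff ℝ 2 G) {R : ℝ} (hR : 0 < R)
    (hlap : ∀ z ∈ ball (0 : ℂ) R, 0 ≤ lapC G z) :
    π * R ^ 2 * G 0 ≤ ∫ z in ball (0 : ℂ) R, G z := by
  have hG1 : ContDiff ℝ 1 (fderiv ℝ G) := hG.fderiv_right (by norm_num)
  have hD0 : Differentiable ℝ G := hG.differentiable two_ne_zero
  have hD1 : Differentiable ℝ (fderiv ℝ G) := hG1.differentiable one_ne_zero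
  have hc0 : Continuous G := hG.continuous
  have hc1 : Continuous (fderiv ℝ G) := hG1.continuous
  have hc2 : Continuous (fderiv ℝ (fderiv ℝ G)) := hG1.continuous_fderiv one_ne_zero
  have hcl := continuous_lapC hG
  have hev : Continuous fun p : ℝ × ℝ => ev p.2 := ev_continuous.comp continuous_snd
  have hpt : Continuous fun p : ℝ × ℝ => (p.1 : ℂ) * ev p.2 :=
    (Complex.continuous_ofReal.comp continuous_fst).mul hev
  let K : ℝ → ℝ → ℝ := fun s θ => fderiv ℝ G (s * ev θ) (ev θ)
  let M : ℝ → ℝ → ℝ := fun s θ => K s θ + s * fderiv ℝ (fderiv ℝ G) (s * ev θ) (ev θ) (ev θ)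
  have hK : Continuous (Function.uncurry K) := (hc1.comp hpt).clm_apply hev
  have hM : Continuous (Function.uncurry M) :=
    hK.add (continuous_fst.mul (((hc2.comp hpt).clm_apply hev).clm_apply hev))
  have left (r : ℝ) {F : ℝ → ℝ → ℝ} (hF : Continuous (Function.uncurry F)) : Continuous (F r) :=
    hF.comp (by fun_prop : Continuous fun θ => (r, θ))
  have right (θ : ℝ) {F : ℝ → ℝ → ℝ} (hF : Continuous (Function.uncurry F)) :
    Continuous (fun r => F r θ) := hF.comp (by fun_prop : Continuous fun r => (r, θ))
  have hMint : ∀ s, 0 < s → s < R → 0 ≤ ∫ θ in (-π)..π, M s θ := by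
    intro s hs hsR
    have hder : ∀ θ, HasDerivAt (fun t => fderiv ℝ G (s * ev t) (Complex.I * ev t))
        (s * fderiv ℝ (fderiv ℝ G) (s * ev θ) (Complex.I * ev θ) (Complex.I * ev θ) - K s θ) θ := by
      intro θ
      have h1 := hasDerivAt_angular (r := s) (θ := θ) (hD1 _)
      have h2 := (ev_hasDerivAt θ).const_mul Complex.I
      refine (h1.clm_apply h2).congr_deriv ?_
      simp only [K, _root_.smul_apply, smul_eq_mul]
      rw [← mul_assoc, Complex.I_mul_I, neg_one_mul, map_neg, sub_eq_add_neg]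
    have hcN : Continuous fun θ => s * fderiv ℝ (fderiv ℝ G) (s * ev θ) (Complex.I * ev θ)
        (Complex.I * ev θ) - K s θ := by
      have := left s hK
      have h2 : Continuous fun θ => fderiv ℝ (fderiv ℝ G) (s * ev θ) :=
        hc2.comp (continuous_const.mul ev_continuous)
      have h3 := continuous_const (y := Complex.I).mul ev_continuous
      exact (continuous_const.mul ((h2.clm_apply h3).clm_apply h3)).sub this
    have h0 := intervalIntegral.integral_eq_sub_of_hasDerivAt (a := -π) (b := π)
      (fun θ _ => hder θ) (hcN.intervalIntegrable _ _)
    rw [ev_pi, sub_self] at h0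
    have h4 : ∫ θ in (-π)..π, M s θ = ∫ θ in (-π)..π, s * lapC G (s * ev θ) := by
      rw [← add_zero (∫ θ in (-π)..π, M s θ), ← h0, ← intervalIntegral.integral_add
        ((left s hM).intervalIntegrable _ _) (hcN.intervalIntegrable _ _)]
      refine intervalIntegral.integral_congr fun θ _ => ?_
      simp only [M]
      rw [lapC_eq hG, ← bilin_rotate _ θ]
      ring
    rw [h4]
    refine intervalIntegral.integral_nonneg (by linarith [Real.pi_pos]) fun θ _ => ?_
    refine mul_nonneg hs.le (hlap _ ?_)
    simpa [norm_ev, abs_of_pos hs] using hsR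
  have hKint : ∀ ρ, 0 < ρ → ρ ≤ R → 0 ≤ ∫ θ in (-π)..π, K ρ θ := by
    intro ρ hρ hρR
    have h1 : ∀ θ, ∫ s in (0:ℝ)..ρ, M s θ = ρ * K ρ θ := by
      intro θ
      have := intervalIntegral.integral_eq_sub_of_hasDerivAt (a := 0) (b := ρ)
        (f := fun s => s * K s θ) (f' := fun s => M s θ) (fun s _ => ?_)
        ((right θ hM).intervalIntegrable _ _)
      · simpa using this
      · have := (hasDerivAt_id s).mul
          ((hasDerivAt_radial (r := s) (θ := θ) (hD1 _)).clm_apply (hasDerivAt_const s (ev θ)))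
        refine this.congr_deriv ?_
        simp [M, K]
    have h2 : 0 ≤ ∫ s in (0:ℝ)..ρ, ∫ θ in (-π)..π, M s θ := by
      rw [intervalIntegral.integral_of_le hρ.le, integral_Ioc_eq_integral_Ioo]
      exact setIntegral_nonneg measurableSet_Ioo fun s hs => hMint s hs.1 (hs.2.trans_le hρR)
    rw [integral_swap_of_continuous hM] at h2
    simp_rw [h1] at h2
    rw [intervalIntegral.integral_const_mul] at h2
    exact nonneg_of_mul_nonneg_right h2 hρ
  have hmean : ∀ r, 0 ≤ r → r ≤ R → 2 * π * G 0 ≤ ∫ θ in (-π)..π, G (r * ev θ) := by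
    intro r hr hrR
    have h1 : ∀ θ, ∫ s in (0:ℝ)..r, K s θ = G (r * ev θ) - G 0 := by
      intro θ
      have := intervalIntegral.integral_eq_sub_of_hasDerivAt (a := 0) (b := r)
        (fun s _ => hasDerivAt_radial (r := s) (θ := θ) (hD0 _))
        ((right θ hK).intervalIntegrable _ _)
      simpa using this
    have h2 : 0 ≤ ∫ s in (0:ℝ)..r, ∫ θ in (-π)..π, K s θ := by
      rw [intervalIntegral.integral_of_le hr]
      exact setIntegral_nonneg measurableSet_Ioc fun s hs => hKint s hs.1 (hs.2.trans hrR)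
    rw [integral_swap_of_continuous hK] at h2
    simp_rw [h1] at h2
    have hcr : Continuous fun θ => G (r * ev θ) := hc0.comp (continuous_const.mul ev_continuous)
    rw [intervalIntegral.integral_sub (hcr.intervalIntegrable _ _) (by simp)] at h2
    simp only [intervalIntegral.integral_const, smul_eq_mul] at h2
    linarith
  have hKG : Continuous (Function.uncurry fun r θ : ℝ => r * G (r * ev θ)) :=
    continuous_fst.mul (hc0.comp hpt)
  rw [integral_ball_polar hKG hR.le (fun r _ _ θ => rfl)]
  have h5 : ∫ r in (0:ℝ)..R, r * (2 * π * G 0) = π * R ^ 2 * G 0 := by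
    rw [intervalIntegral.integral_mul_const, integral_id]; ring
  rw [← h5]
  have hcint : Continuous fun r : ℝ => ∫ θ in (-π)..π, r * G (r * ev θ) :=
    intervalIntegral.continuous_parametric_intervalIntegral_of_continuous' hKG _ _
  refine intervalIntegral.integral_mono_on hR.le
    ((continuous_id.mul continuous_const).intervalIntegrable _ _)
    (hcint.intervalIntegrable _ _) fun r hr => ?_
  rw [intervalIntegral.integral_const_mul]
  exact mul_le_mul_of_nonneg_left (hmean r hr.1 hr.2) hr.1

theorem setIntegral_ball_add (G : ℂ → ℝ) (c : ℂ) (R : ℝ) :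
    ∫ z in ball (0 : ℂ) R, G (z + c) = ∫ z in ball c R, G z := by
  have := (measurePreserving_add_right (volume : Measure ℂ) c).setIntegral_preimage_emb
    (MeasurableEquiv.addRight c).measurableEmbedding G (ball c R)
  rw [← this]
  congr 2
  ext z; simp

theorem lapC_add_right (v : ℂ → ℝ) (c z : ℂ) : lapC (fun w => v (w + c)) z = lapC v (z + c) := by
  have h : ∀ (a : ℂ), (fun w => fderiv ℝ (fun w => v (w + c)) w a) =
      fun w => (fun w => fderiv ℝ v w a) (w + c) := by
    intro a; funext w; rw [fderiv_comp_add_right]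
  simp only [lapC]
  rw [h, h, fderiv_comp_add_right (f := fun w => fderiv ℝ v w 1),
    fderiv_comp_add_right (f := fun w => fderiv ℝ v w Complex.I)]

theorem sub_mean_value {G : ℂ → ℝ} (hG : ContDiff ℝ 2 G) (c : ℂ) {R : ℝ} (hR : 0 < R)
    (hlap : ∀ z ∈ ball c R, 0 ≤ lapC G z) :
    π * R ^ 2 * G c ≤ ∫ z in ball c R, G z := by
  have := sub_mean_value_zero (G := fun z => G (z + c))
    (hG.comp (contDiff_id.add contDiff_const)) hR
    (fun z hz => by rw [lapC_add_right]; exact hlap _ (by simpa using hz))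
  simpa [setIntegral_ball_add] using this

theorem lapC_add {v w : ℂ → ℝ} (hv : ContDiff ℝ 2 v) (hw : ContDiff ℝ 2 w) (z : ℂ) :
    lapC (fun y => v y + w y) z = lapC v z + lapC w z := by
  have hv1 : ContDiff ℝ 1 (fderiv ℝ v) := hv.fderiv_right (by norm_num)
  have hw1 : ContDiff ℝ 1 (fderiv ℝ w) := hw.fderiv_right (by norm_num)
  have e : fderiv ℝ (fun y => v y + w y) = fun y => fderiv ℝ v y + fderiv ℝ w y := by
    funext y
    exact fderiv_fun_add (hv.differentiable two_ne_zero y) (hw.differentiable two_ne_zero y)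
  rw [lapC_eq (hv.add hw), lapC_eq hv, lapC_eq hw, e,
    fderiv_fun_add (hv1.differentiable one_ne_zero z) (hw1.differentiable one_ne_zero z)]
  simp only [_root_.add_apply]; ring

theorem lapC_const_mul {v : ℂ → ℝ} (hv : ContDiff ℝ 2 v) (a : ℝ) (z : ℂ) :
    lapC (fun y => a * v y) z = a * lapC v z := by
  have hv1 : ContDiff ℝ 1 (fderiv ℝ v) := hv.fderiv_right (by norm_num)
  have e : fderiv ℝ (fun y => a * v y) = fun y => a • fderiv ℝ v y := by
    funext y
    exact fderiv_const_mul (hv.differentiable two_ne_zero y) a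
  rw [lapC_eq (contDiff_const.mul hv), lapC_eq hv, e,
    fderiv_fun_const_smul (hv1.differentiable one_ne_zero z)]
  simp only [_root_.smul_apply, smul_eq_mul]; ring

theorem lapC_exp {v : ℂ → ℝ} (hv : ContDiff ℝ 2 v) (z : ℂ) :
    lapC (fun y => exp (v y)) z =
      exp (v z) * (lapC v z + (fderiv ℝ v z 1) ^ 2 + (fderiv ℝ v z Complex.I) ^ 2) := by
  have hv1 : ContDiff ℝ 1 (fderiv ℝ v) := hv.fderiv_right (by norm_num)
  have hd := hv.differentiable two_ne_zero
  have e : fderiv ℝ (fun y => exp (v y)) = fun y => exp (v y) • fderiv ℝ v y := by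
    funext y
    exact ((hd y).hasFDerivAt.exp).fderiv
  have e' : fderiv ℝ (fun y => exp (v y) • fderiv ℝ v y) z = _ :=
    (((hd z).hasFDerivAt.exp).smul (hv1.differentiable one_ne_zero z).hasFDerivAt).fderiv
  rw [lapC_eq hv.exp, lapC_eq hv, e, e']
  simp; ring

theorem lapC_norm_sq (c z : ℂ) : lapC (fun y => ‖y - c‖ ^ 2) z = 4 := by
  have e : ∀ a : ℂ, (fun w => fderiv ℝ (fun y : ℂ => ‖y - c‖ ^ 2) w a) =
      fun w => 2 * inner ℝ (w - c) a := by
    intro a; funext w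
    have h : fderiv ℝ (fun y : ℂ => ‖y - c‖ ^ 2) w = _ :=
      (((hasFDerivAt_id w).sub_const c).norm_sq).fderiv
    rw [h]
    simp; ring
  have e2 : ∀ a : ℂ, fderiv ℝ (fun w : ℂ => 2 * inner ℝ (w - c) a) z a = 2 * inner ℝ a a := by
    intro a
    have := ((((hasFDerivAt_id z).sub_const c).inner ℝ (hasFDerivAt_const a z)).const_mul
      (2 : ℝ)).fderiv
    simp only [id] at this
    rw [this]; simp
  simp only [lapC]
  rw [e, e, e2, e2]
  simp; norm_num

theorem exp_mean_value {v : ℂ → ℝ} (hv : ContDiff ℝ 2 v) (c : ℂ) {r l : ℝ} (hr : 0 < r)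
    (hl : 0 ≤ l) (hlap : ∀ z ∈ ball c r, - (8 * l) ≤ lapC v z) :
    π * r ^ 2 * exp (v c) ≤ exp (2 * l * r ^ 2) * ∫ z in ball c r, exp (v z) := by
  have hq : ContDiff ℝ 2 fun y : ℂ => ‖y - c‖ ^ 2 := (contDiff_id.sub contDiff_const).norm_sq ℝ
  have hq2 : ContDiff ℝ 2 fun y : ℂ => 2 * l * ‖y - c‖ ^ 2 := contDiff_const.mul hq
  have hφ : ContDiff ℝ 2 fun y : ℂ => v y + 2 * l * ‖y - c‖ ^ 2 := hv.add hq2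
  have h := sub_mean_value (G := fun y => exp (v y + 2 * l * ‖y - c‖ ^ 2)) hφ.exp c hr ?_
  · simp only [sub_self, norm_zero] at h
    norm_num at h
    refine h.trans ?_
    rw [← integral_const_mul]
    refine setIntegral_mono_on ?_ ?_ measurableSet_ball fun z hz => ?_
    · exact (hφ.exp.continuous.continuousOn.integrableOn_compact
        (isCompact_closedBall c r)).mono_set ball_subset_closedBall
    · exact ((continuous_const.mul hv.exp.continuous).continuousOn.integrableOn_compact
        (isCompact_closedBall c r)).mono_set ball_subset_closedBall
    · rw [exp_add, mul_comm]
      have : ‖z - c‖ ≤ r := by rw [← dist_eq_norm]; exact (mem_ball.1 hz).le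
      gcongr
  · intro z hz
    rw [lapC_exp hφ, lapC_add hv hq2, lapC_const_mul hq, lapC_norm_sq]
    have := hlap z hz
    have h2 : 0 ≤ lapC v z + 2 * l * 4 := by linarith
    positivity

/-- An `ε`-regularity estimate for `Δv ≥ -2eᵛ`. -/
theorem eps_regularity {v : ℂ → ℝ} (hv : ContDiff ℝ 2 v) (hlap : ∀ z, -(2 * exp (v z)) ≤ lapC v z)
    (c : ℂ) {ρ : ℝ} (hρ : 0 < ρ) (hε : ∫ z in ball c ρ, exp (v z) ≤ 1 / 2) :
    ρ ^ 2 * exp (v c) ≤ 4 * ∫ z in ball c ρ, exp (v z) := by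
  have hcont : Continuous fun z => (ρ - ‖z - c‖) ^ 2 * exp (v z) := by
    have := hv.continuous
    fun_prop
  obtain ⟨x, hx, hmax⟩ := (isCompact_closedBall c ρ).exists_isMaxOn
    ⟨c, mem_closedBall_self hρ.le⟩ hcont.continuousOn
  have hM := hmax (mem_closedBall_self hρ.le)
  simp only [sub_self, norm_zero, sub_zero, Set.mem_ofPred_eq] at hM
  have hxρ : ‖x - c‖ ≤ ρ := by rw [← dist_eq_norm]; exact hx
  have hlt : 0 < ρ - ‖x - c‖ := by
    rcases hxρ.lt_or_eq with h | h
    · linarith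
    · rw [h] at hM
      have : 0 < ρ ^ 2 * exp (v c) := by positivity
      norm_num at hM
      linarith
  obtain ⟨δ, hδ⟩ : ∃ δ, δ = (ρ - ‖x - c‖) / 2 := ⟨_, rfl⟩
  have hδ0 : 0 < δ := by rw [hδ]; linarith
  have h2δ : ρ - ‖x - c‖ = 2 * δ := by rw [hδ]; ring
  obtain ⟨l, hl⟩ : ∃ l, l = exp (v x) := ⟨_, rfl⟩
  have hl0 : 0 < l := hl ▸ exp_pos _
  rw [h2δ, ← hl] at hM
  have htri : ∀ z ∈ ball x δ, δ ≤ ρ - ‖z - c‖ := by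
    intro z hz
    have h1 : ‖z - x‖ < δ := by rw [← dist_eq_norm]; exact hz
    have h2 : ‖z - c‖ ≤ ‖z - x‖ + ‖x - c‖ := by
      simpa using norm_add_le (z - x) (x - c)
    linarith
  have hlap' : ∀ z ∈ ball x δ, -(8 * l) ≤ lapC v z := by
    intro z hz
    have h1 := htri z hz
    have h2 := hmax (show z ∈ closedBall c ρ by
      rw [mem_closedBall, dist_eq_norm]; linarith)
    simp only [Set.mem_ofPred_eq] at h2
    rw [h2δ, ← hl] at h2
    have h3 : δ ^ 2 * exp (v z) ≤ δ ^ 2 * (4 * l) := by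
      refine le_trans ?_ (h2.trans (by ring_nf; rfl))
      gcongr
    have h4 := le_of_mul_le_mul_left h3 (by positivity)
    linarith [hlap z]
  set ε := ∫ z in ball c ρ, exp (v z) with hεdef
  have hmv : ∀ r, 0 < r → r ≤ δ → π * r ^ 2 * l ≤ exp (2 * l * r ^ 2) * ε := by
    intro r hr hrδ
    have := exp_mean_value hv x hr hl0.le fun z hz => hlap' z (ball_subset_ball hrδ hz)
    rw [hl]
    rw [hl] at this
    refine this.trans ?_
    refine mul_le_mul_of_nonneg_left ?_ (exp_pos _).le
    refine setIntegral_mono_set ?_ (Eventually.of_forall fun z => (exp_pos _).le) ?_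
    · exact (hv.exp.continuous.continuousOn.integrableOn_compact
        (isCompact_closedBall c ρ)).mono_set ball_subset_closedBall
    · refine LE.le.eventuallyLE fun z hz => ?_
      have := htri z (ball_subset_ball hrδ hz)
      rw [mem_ball, dist_eq_norm]; linarith
  have he : exp 1 < π := by linarith [exp_one_lt_d9, Real.pi_gt_three]
  have hε0 : 0 ≤ ε := setIntegral_nonneg measurableSet_ball fun z _ => (exp_pos _).le
  have hcase : l * δ ^ 2 < 1 / 2 := by
    by_contra! hge
    have hs : √(1 / (2 * l)) ^ 2 = 1 / (2 * l) := Real.sq_sqrt (by positivity)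
    have h1 := hmv (√(1 / (2 * l))) (by positivity) (by
      rw [Real.sqrt_le_left hδ0.le, div_le_iff₀ (by positivity)]; linarith)
    rw [hs] at h1
    have e1 : 2 * l * (1 / (2 * l)) = 1 := by field_simp
    have e2 : π * (1 / (2 * l)) * l = π / 2 := by field_simp
    rw [e1, e2] at h1
    have : exp 1 * ε ≤ exp 1 * (1 / 2) := by gcongr
    linarith
  have h1 := hmv δ hδ0 le_rfl
  have h2 : exp (2 * l * δ ^ 2) ≤ π := by
    refine le_trans ?_ he.le
    exact exp_le_exp.2 (by linarith)
  have h3 : π * (l * δ ^ 2) ≤ π * ε := by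
    calc π * (l * δ ^ 2) = π * δ ^ 2 * l := by ring
      _ ≤ _ := h1
      _ ≤ π * ε := by gcongr
  have h4 := le_of_mul_le_mul_left h3 Real.pi_pos
  linarith

instance : (Bornology.cobounded ℂ).IsCountablyGenerated := by
  rw [← comap_norm_atTop]; infer_instance

theorem tendsto_integral_tail {f : ℂ → ℝ} (hf : Integrable f) :
    Tendsto (fun z : ℂ => ∫ w in (ball (0 : ℂ) (‖z‖ / 2))ᶜ, f w) (Bornology.cobounded ℂ) (𝓝 0) := by
  have h := tendsto_integral_filter_of_dominated_convergence (l := Bornology.cobounded ℂ)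
    (F := fun z w => ((ball (0 : ℂ) (‖z‖ / 2))ᶜ).indicator f w) (f := fun _ => (0 : ℝ))
    (μ := volume) (fun w => ‖f w‖)
    (Eventually.of_forall fun z => hf.aestronglyMeasurable.indicator measurableSet_ball.compl)
    (Eventually.of_forall fun z => Eventually.of_forall fun w => norm_indicator_le_norm_self _ _)
    hf.norm
    (Eventually.of_forall fun w => by
      refine tendsto_const_nhds.congr' ?_
      filter_upwards [tendsto_norm_cobounded_atTop.eventually_gt_atTop (2 * ‖w‖)] with z hz
      rw [Set.indicator_of_notMem]
      simp only [Set.mem_compl_iff, mem_ball_zero_iff, not_not]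
      linarith)
  simp only [integral_zero] at h
  refine h.congr fun z => ?_
  rw [integral_indicator measurableSet_ball.compl]

theorem tendsto_norm_sq_mul_exp {v : ℂ → ℝ} (hv : ContDiff ℝ 2 v)
    (hlap : ∀ z, -(2 * exp (v z)) ≤ lapC v z) (hint : Integrable fun z => exp (v z)) :
    Tendsto (fun z : ℂ => ‖z‖ ^ 2 * exp (v z)) (Bornology.cobounded ℂ) (𝓝 0) := by
  have ht := tendsto_integral_tail hint
  refine squeeze_zero' (Eventually.of_forall fun z => by positivity) ?_
    (by simpa using ht.const_mul 16)
  filter_upwards [tendsto_norm_cobounded_atTop.eventually_gt_atTop 0,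
    ht.eventually (gt_mem_nhds (show (0 : ℝ) < 1 / 2 by norm_num))] with z hz hz2
  have hle : ∫ w in ball z (‖z‖ / 2), exp (v w) ≤ ∫ w in (ball (0 : ℂ) (‖z‖ / 2))ᶜ, exp (v w) := by
    refine setIntegral_mono_set hint.integrableOn (Eventually.of_forall fun z => (exp_pos _).le)
      (LE.le.eventuallyLE fun w hw => ?_)
    rw [mem_ball, dist_eq_norm] at hw
    simp only [Set.mem_compl_iff, mem_ball_zero_iff, not_lt]
    have := norm_sub_norm_le z w
    rw [norm_sub_rev] at this
    linarith
  have := eps_regularity hv hlap z (half_pos hz) (hle.trans hz2.le)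
  nlinarith

theorem integrable_inv_mul {g : ℂ → ℂ} (hg : Continuous g) (hi : Integrable g) (z : ℂ) :
    Integrable fun t => t⁻¹ * g (z - t) := by
  have hgz : Continuous fun t => g (z - t) := by fun_prop
  have hiz : Integrable fun t => g (z - t) := hi.comp_sub_left z
  rw [← integrableOn_univ, ← Set.union_compl_self (closedBall (0 : ℂ) 1)]
  refine IntegrableOn.union ?_ ?_
  · exact (locallyIntegrable_inv.integrableOn_isCompact (isCompact_closedBall 0 1)).mul_continuousOn
      hgz.continuousOn (isCompact_closedBall 0 1)
  · refine hiz.norm.integrableOn.mono' (measurable_inv.aestronglyMeasurable.mul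
      hgz.aestronglyMeasurable) ?_
    filter_upwards [ae_restrict_mem measurableSet_closedBall.compl] with t ht
    have h1 : 1 ≤ ‖t‖ := by
      simp only [Set.mem_compl_iff, mem_closedBall_zero_iff, not_le] at ht; exact ht.le
    rw [norm_mul, norm_inv]
    exact mul_le_of_le_one_left (norm_nonneg _) (inv_le_one_of_one_le₀ h1)

theorem differentiable_sub_cauchyT {p : ℂ → ℂ} (hp : ContDiff ℝ 1 p) (hg : ContDiff ℝ 1 (dzb p))
    (hi : Integrable (dzb p)) : Differentiable ℂ fun z => p z - cauchyT (dzb p) z := by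
  set g := dzb p with hgdef
  let χ : ℕ → ContDiffBump (0 : ℂ) := fun n => ⟨n + 1, n + 2, by positivity, by linarith⟩
  let h : ℕ → ℂ → ℂ := fun n w => (χ n w : ℂ) * g w
  have hχ : ∀ n, ContDiff ℝ 1 fun w => ((χ n w : ℝ) : ℂ) := fun n =>
    Complex.ofRealCLM.contDiff.comp (χ n).contDiff
  have hh : ∀ n, ContDiff ℝ 1 (h n) := fun n => (hχ n).mul hg
  have hcs : ∀ n, HasCompactSupport (h n) := fun n =>
    HasCompactSupport.mul_right ((χ n).hasCompactSupport.comp_left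
      (g := fun x : ℝ => (x : ℂ)) (by simp))
  have hhol : ∀ n : ℕ, DifferentiableOn ℂ (fun w => p w - cauchyT (h n) w) (ball 0 n) := by
    intro n w hw
    have d1 := (hp.differentiable one_ne_zero) w
    have d2 := ((cauchyT_contDiff (n := 1) (hh n) (hcs n)).differentiable one_ne_zero) w
    refine (differentiableAt_of_dzb_eq_zero (f := fun w => p w - cauchyT (h n) w) (d1.sub d2)
      ?_).differentiableWithinAt
    rw [dzb_sub d1 d2, dzb_cauchyT (hh n) (hcs n)]
    have hw' : w ∈ closedBall (0 : ℂ) (n + 1) :=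
      (ball_subset_closedBall.trans (closedBall_subset_closedBall (by linarith))) hw
    simp only [h]
    rw [(χ n).one_of_mem_closedBall hw']
    simp [hgdef]
  have hest : ∀ (n : ℕ) (r : ℝ) (z : ℂ), ‖z‖ ≤ r → r < n →
      ‖cauchyT g z - cauchyT (h n) z‖ ≤ π⁻¹ * ((n - r)⁻¹ * ∫ w, ‖g w‖) := by
    intro n r z hz hr
    have i1 := integrable_inv_mul hg.continuous hi z
    have i2 := integrable_inv_mul (hh n).continuous
      ((hh n).continuous.integrable_of_hasCompactSupport (hcs n)) z
    rw [cauchyT, cauchyT, ← mul_sub, ← integral_sub i1 i2, norm_mul]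
    have : ‖(π : ℂ)⁻¹‖ = π⁻¹ := by simp [abs_of_pos Real.pi_pos]
    rw [this]
    gcongr
    rw [← integral_const_mul, ← integral_sub_left_eq_self (fun w => (n - r)⁻¹ * ‖g w‖) volume z]
    refine norm_integral_le_of_norm_le ((hi.norm.const_mul _).comp_sub_left z)
      (Eventually.of_forall fun t => ?_)
    have e : t⁻¹ * g (z - t) - t⁻¹ * h n (z - t) =
        t⁻¹ * ((1 - χ n (z - t) : ℝ) : ℂ) * g (z - t) := by
      simp only [h]; push_cast; ring
    rw [e]
    have hnr : 0 < (n : ℝ) - r := by linarith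
    by_cases ht : z - t ∈ closedBall (0 : ℂ) (n + 1)
    · rw [(χ n).one_of_mem_closedBall ht]
      simp only [sub_self, Complex.ofReal_zero, mul_zero, zero_mul, norm_zero]
      positivity
    · rw [mem_closedBall_zero_iff, not_le] at ht
      have h1 : (n : ℝ) - r ≤ ‖t‖ := by
        have := norm_sub_le z t
        linarith
      have h2 : ‖((1 - χ n (z - t) : ℝ) : ℂ)‖ ≤ 1 := by
        rw [Complex.norm_real, Real.norm_eq_abs, abs_le]
        constructor
        · have := (χ n).le_one (x := z - t); linarith
        · have := (χ n).nonneg (x := z - t); linarith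
      rw [norm_mul, norm_mul, norm_inv]
      gcongr
      calc ‖t‖⁻¹ * _ ≤ ‖t‖⁻¹ * 1 := by gcongr
        _ ≤ _ := by rw [mul_one]; exact inv_anti₀ hnr h1
  intro z
  obtain ⟨m, hm⟩ := exists_nat_gt ‖z‖
  have hlim : TendstoLocallyUniformlyOn (fun n w => p w - cauchyT (h n) w)
      (fun z => p z - cauchyT g z) atTop (ball 0 m) := by
    refine TendstoUniformlyOn.tendstoLocallyUniformlyOn ?_
    rw [Metric.tendstoUniformlyOn_iff]
    intro ε hε
    have ht : Tendsto (fun n : ℕ => π⁻¹ * (((n : ℝ) - m)⁻¹ * ∫ w, ‖g w‖)) atTop (𝓝 0) := by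
      have : Tendsto (fun n : ℕ => (n : ℝ) - m) atTop atTop :=
        tendsto_atTop_add_const_right _ _ tendsto_natCast_atTop_atTop
      simpa using (this.inv_tendsto_atTop.mul_const _).const_mul π⁻¹
    filter_upwards [ht.eventually (gt_mem_nhds hε), eventually_gt_atTop m] with n hn hnm w hw
    refine lt_of_le_of_lt ?_ hn
    rw [dist_eq_norm, sub_sub_sub_cancel_left, norm_sub_rev]
    exact hest n m w (mem_ball_zero_iff.1 hw).le (by exact_mod_cast hnm)
  have := hlim.differentiableOn (by
    filter_upwards [eventually_ge_atTop m] with n hn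
    exact (hhol n).mono (ball_subset_ball (by exact_mod_cast hn))) isOpen_ball
  exact (this z (mem_ball_zero_iff.2 hm)).differentiableAt
    (isOpen_ball.mem_nhds (mem_ball_zero_iff.2 hm))

theorem tendsto_mul_cauchyT {g : ℂ → ℂ} (hg : Continuous g) (hi : Integrable g)
    (hdec : Tendsto (fun z => ‖z‖ ^ 2 * ‖g z‖) (Bornology.cobounded ℂ) (𝓝 0)) :
    Tendsto (fun z => z * cauchyT g z) (Bornology.cobounded ℂ) (𝓝 ((π : ℂ)⁻¹ * ∫ w, g w)) := by
  let S : ℂ → Set ℂ := fun z => ball 0 (‖z‖ / 2)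
  have hinv : Measurable fun t : ℂ => t⁻¹ := measurable_inv
  have hfar : Tendsto (fun z => ∫ t, ((S z)ᶜ).indicator (fun t => z * (t⁻¹ * g (z - t))) t)
      (Bornology.cobounded ℂ) (𝓝 (∫ w, g w)) := by
    have hconv : ∀ z, ∫ t, ((S z)ᶜ).indicator (fun t => z * (t⁻¹ * g (z - t))) t =
        ∫ w, ((S z)ᶜ).indicator (fun t => z * (t⁻¹ * g (z - t))) (z - w) := fun z =>
      (integral_sub_left_eq_self _ volume z).symm
    simp_rw [hconv]
    refine tendsto_integral_filter_of_dominated_convergence (fun w => 2 * ‖g w‖)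
      (Eventually.of_forall fun z => ?_) ?_ (hi.norm.const_mul 2) (Eventually.of_forall fun w => ?_)
    · have : Measurable (((S z)ᶜ).indicator (fun t => z * (t⁻¹ * g (z - t)))) :=
        Measurable.indicator (measurable_const.mul
          (hinv.mul (hg.comp (continuous_const.sub continuous_id)).measurable))
          measurableSet_ball.compl
      exact (this.comp (measurable_const.sub measurable_id)).aestronglyMeasurable
    · filter_upwards [tendsto_norm_cobounded_atTop.eventually_gt_atTop 0] with z hz
      refine Eventually.of_forall fun w => ?_
      by_cases hw : z - w ∈ (S z)ᶜ
      · rw [Set.indicator_of_mem hw]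
        simp only [S, Set.mem_compl_iff, mem_ball_zero_iff, not_lt] at hw
        rw [sub_sub_cancel, norm_mul, norm_mul, norm_inv, ← mul_assoc]
        gcongr
        rw [← div_eq_mul_inv, div_le_iff₀ (by linarith)]
        linarith
      · rw [Set.indicator_of_notMem hw, norm_zero]
        positivity
    · have h1 : Tendsto (fun z : ℂ => z * (z - w)⁻¹) (Bornology.cobounded ℂ) (𝓝 1) := by
        have h2 : Tendsto (fun z : ℂ => 1 - w * z⁻¹) (Bornology.cobounded ℂ) (𝓝 1) := by
          simpa using (tendsto_inv₀_cobounded (α := ℂ)).const_mul w |>.const_sub 1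
        have h3 := h2.inv₀ one_ne_zero
        rw [inv_one] at h3
        refine h3.congr' ?_
        filter_upwards [tendsto_norm_cobounded_atTop.eventually_gt_atTop 0,
          tendsto_norm_cobounded_atTop.eventually_gt_atTop ‖w‖] with z hz hzw
        have z0 : z ≠ 0 := norm_pos_iff.1 hz
        have zw : z - w ≠ 0 := fun h => by rw [sub_eq_zero.1 h] at hzw; exact lt_irrefl _ hzw
        have : 1 - w * z⁻¹ = (z - w) * z⁻¹ := by field_simp
        rw [this, mul_inv, inv_inv, mul_comm]
      have h2 := h1.mul_const (g w)
      rw [one_mul] at h2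
      refine h2.congr' ?_
      filter_upwards [tendsto_norm_cobounded_atTop.eventually_gt_atTop (2 * ‖w‖)] with z hz
      rw [Set.indicator_of_mem]
      · rw [sub_sub_cancel]; ring
      · simp only [S, Set.mem_compl_iff, mem_ball_zero_iff, not_lt]
        have := norm_sub_norm_le z w
        linarith
  have hnear : Tendsto (fun z => ∫ t in S z, z * (t⁻¹ * g (z - t)))
      (Bornology.cobounded ℂ) (𝓝 0) := by
    rw [Metric.tendsto_nhds]
    intro ε hε
    set δ := ε / (8 * π) with hδ
    have hδ0 : 0 < δ := by positivity
    obtain ⟨R, -, hR⟩ := (hasBasis_cobounded_norm (E := ℂ)).eventually_iff.1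
      (hdec.eventually (gt_mem_nhds hδ0))
    filter_upwards [tendsto_norm_cobounded_atTop.eventually_ge_atTop (2 * R),
      tendsto_norm_cobounded_atTop.eventually_gt_atTop 0] with z hz hz0
    rw [dist_zero_right]
    have hb : ∀ t ∈ S z, ‖z * (t⁻¹ * g (z - t))‖ ≤ 4 * δ / ‖z‖ * ‖t‖⁻¹ := by
      intro t ht
      simp only [S, mem_ball_zero_iff] at ht
      have h1 : ‖z‖ / 2 ≤ ‖z - t‖ := by
        have := norm_sub_norm_le z t
        linarith
      have h2 := hR (show z - t ∈ _ by
        simp only [Set.mem_ofPred_eq]; linarith)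
      have h3 : ‖g (z - t)‖ ≤ 4 * δ / ‖z‖ ^ 2 := by
        rw [le_div_iff₀ (by positivity)]
        have : (‖z‖ / 2) ^ 2 * ‖g (z - t)‖ ≤ ‖z - t‖ ^ 2 * ‖g (z - t)‖ := by gcongr
        nlinarith
      rw [norm_mul, norm_mul, norm_inv]
      calc ‖z‖ * (‖t‖⁻¹ * ‖g (z - t)‖) ≤ ‖z‖ * (‖t‖⁻¹ * (4 * δ / ‖z‖ ^ 2)) := by gcongr
        _ = _ := by field_simp
    have hin : IntegrableOn (fun t : ℂ => ‖t‖⁻¹) (S z) := by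
      have := (locallyIntegrable_inv.integrableOn_isCompact (isCompact_closedBall 0 (‖z‖ / 2))).norm
      simp only [norm_inv] at this
      exact IntegrableOn.mono_set this ball_subset_closedBall
    calc ‖∫ t in S z, z * (t⁻¹ * g (z - t))‖ ≤ ∫ t in S z, 4 * δ / ‖z‖ * ‖t‖⁻¹ :=
          norm_integral_le_of_norm_le (hin.const_mul _)
            ((ae_restrict_mem measurableSet_ball).mono hb)
      _ = 4 * δ / ‖z‖ * (2 * π * (‖z‖ / 2)) := by
          rw [integral_const_mul, integral_inv_norm_ball (by positivity)]
      _ = ε / 2 := by rw [hδ]; field_simp; ring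
      _ < ε := by linarith
  have := (hfar.add hnear).const_mul (π : ℂ)⁻¹
  rw [add_zero] at this
  refine this.congr fun z => ?_
  have i1 : Integrable fun t => z * (t⁻¹ * g (z - t)) := (integrable_inv_mul hg hi z).const_mul z
  rw [integral_indicator measurableSet_ball.compl, add_comm,
    integral_add_compl measurableSet_ball i1, integral_const_mul, cauchyT]
  ring

theorem fderiv_real_apply {v : ℂ → ℝ} {z : ℂ} (hv : DifferentiableAt ℝ v z) (h : ℂ) :
    fderiv ℝ v z h = 2 * (dz (fun w => (v w : ℂ)) z * h).re := by
  have e : fderiv ℝ (fun w => (v w : ℂ)) z = Complex.ofRealCLM ∘L fderiv ℝ v z :=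
    (Complex.ofRealCLM.hasFDerivAt.comp z hv.hasFDerivAt).fderiv
  have e2 : fderiv ℝ v z h = h.re * fderiv ℝ v z 1 + h.im * fderiv ℝ v z Complex.I := by
    conv_lhs => rw [show h = h.re • (1 : ℂ) + h.im • Complex.I by simp [Complex.re_add_im]]
    rw [map_add, map_smul, map_smul]
    simp
  rw [dz, e, e2]
  simp only [ContinuousLinearMap.comp_apply, Complex.ofRealCLM_apply, Complex.mul_re,
    Complex.div_ofNat_re, Complex.div_ofNat_im, Complex.sub_re, Complex.sub_im, Complex.mul_im,
    Complex.ofReal_re, Complex.ofReal_im, Complex.I_re, Complex.I_im]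
  ring

/-- An entire function whose real part grows sublinearly is constant. -/
theorem deriv_eq_zero_of_re_sublinear {F : ℂ → ℂ} (hF : Differentiable ℂ F)
    (h : ∀ ε > 0, ∃ C : ℝ, ∀ z, (F z).re ≤ C + ε * ‖z‖) (z : ℂ) : deriv F z = 0 := by
  by_contra hne
  set d := ‖deriv F z‖ with hd
  have hd0 : 0 < d := norm_pos_iff.2 hne
  obtain ⟨C, hC⟩ := h (d / 100) (by positivity)
  set K := |C| + d * ‖z‖ + ‖F 0‖ + 1 with hK
  have hK0 : 0 < K := by positivity
  set R := ‖z‖ + 100 * K / d with hR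
  have hR0 : 0 < R := by positivity
  have hdR : d * R = d * ‖z‖ + 100 * K := by rw [hR]; field_simp
  have hzK : d * ‖z‖ ≤ K := by
    rw [hK]; have := abs_nonneg C; have := norm_nonneg (F 0); linarith
  have hF0 : ‖F 0‖ ≤ K := by
    rw [hK]; have := abs_nonneg C; have : 0 ≤ d * ‖z‖ := by positivity
    linarith
  have hCK : C ≤ K := by
    rw [hK]; have := le_abs_self C; have : 0 ≤ d * ‖z‖ := by positivity
    have := norm_nonneg (F 0); linarith
  set M := K + d / 100 * (4 * R) with hM
  have hM0 : 0 < M := by positivity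
  have hsph : ∀ w ∈ sphere z R, ‖F w‖ ≤ 2 * M + 3 * K := by
    intro w hw
    have hw' : ‖w‖ ≤ 2 * R := by
      have h1 : ‖w - z‖ = R := by simpa [dist_eq_norm] using hw
      have h2 := norm_add_le (w - z) z
      rw [sub_add_cancel, h1] at h2
      have : 0 < 100 * K / d := by positivity
      linarith
    have := Complex.borelCaratheodory (f := F) (M := M) (R := 4 * R) hM0 hF.differentiableOn
      (fun y hy => by
        rw [mem_ball_zero_iff] at hy
        simp only [Set.mem_ofPred_eq]
        refine (hC y).trans ?_
        rw [hM]; gcongr) (by positivity) (z := w) (by rw [mem_ball_zero_iff]; linarith)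
    refine this.trans ?_
    have h4 : 0 < 4 * R - ‖w‖ := by linarith
    have a1 : 2 * M * ‖w‖ / (4 * R - ‖w‖) ≤ 2 * M := by
      rw [div_le_iff₀ h4]
      nlinarith
    have a2 : ‖F 0‖ * (4 * R + ‖w‖) / (4 * R - ‖w‖) ≤ 3 * K := by
      rw [div_le_iff₀ h4]
      have : ‖F 0‖ * (4 * R + ‖w‖) ≤ K * (4 * R + ‖w‖) := by gcongr
      nlinarith
    linarith
  have := Complex.norm_deriv_le_of_forall_mem_sphere_norm_le hR0 hF.diffContOnCl hsph
  rw [le_div_iff₀ hR0] at this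
  have h5 : M = K + d * R * (4 / 100) := by rw [hM]; ring
  rw [← hd, h5] at this
  have : 0 ≤ d * ‖z‖ := by positivity
  linarith

theorem eq_zero_of_bddAbove {v : ℂ → ℝ} (hv : ContDiff ℝ 1 v) {M : ℝ} (hM : ∀ z, v z ≤ M)
    {E : ℂ → ℂ} (hE : Differentiable ℂ E)
    (hP : Tendsto (fun z => dz (fun w => (v w : ℂ)) z - E z) (Bornology.cobounded ℂ) (𝓝 0))
    (z : ℂ) :
    E z = 0 := by
  obtain ⟨F, hF⟩ := (hE.const_mul (2 : ℂ)).isExactOn_univ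
  have hF' : ∀ z, HasDerivAt F (2 * E z) z := fun z => hF z trivial
  have hFd : Differentiable ℂ F := fun z => (hF' z).differentiableAt
  suffices h : deriv F z = 0 by
    rw [(hF' z).deriv] at h
    simpa using h
  refine deriv_eq_zero_of_re_sublinear hFd (fun ε hε => ?_) z
  let w : ℂ → ℝ := fun y => v y - (F y).re
  have hvd := hv.differentiable one_ne_zero
  have hw : ∀ y, HasFDerivAt w (fderiv ℝ v y - Complex.reCLM ∘L
      ((ContinuousLinearMap.toSpanSingleton ℂ (2 * E y)).restrictScalars ℝ)) y := fun y =>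
    (hvd y).hasFDerivAt.sub
      (Complex.reCLM.hasFDerivAt.comp y ((hF' y).hasFDerivAt.restrictScalars ℝ))
  have hwn : ∀ y, ‖fderiv ℝ w y‖ ≤ 2 * ‖dz (fun w => (v w : ℂ)) y - E y‖ := by
    intro y
    rw [(hw y).fderiv]
    refine ContinuousLinearMap.opNorm_le_bound _ (by positivity) fun h => ?_
    have e : (fderiv ℝ v y - Complex.reCLM ∘L
        ((ContinuousLinearMap.toSpanSingleton ℂ (2 * E y)).restrictScalars ℝ)) h =
        2 * ((dz (fun w => (v w : ℂ)) y - E y) * h).re := by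
      rw [_root_.sub_apply, fderiv_real_apply (hvd y)]
      simp
      ring
    rw [e, Real.norm_eq_abs, abs_mul, abs_two, mul_assoc, ← norm_mul]
    gcongr
    exact Complex.abs_re_le_norm _
  obtain ⟨R, -, hR⟩ := (hasBasis_cobounded_norm (E := ℂ)).eventually_iff.1
    ((tendsto_zero_iff_norm_tendsto_zero.1 hP).eventually (gt_mem_nhds (half_pos hε)))
  simp only [Set.mem_ofPred_eq] at hR
  set ρ := max R 1 with hρ
  have hρ0 : 0 < ρ := lt_of_lt_of_le one_pos (le_max_right _ _)
  have hwc : Continuous w := continuous_iff_continuousAt.2 fun y => (hw y).continuousAt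
  obtain ⟨C, hC⟩ := (isCompact_closedBall (0 : ℂ) ρ).exists_bound_of_continuousOn hwc.continuousOn
  have hC0 : 0 ≤ C := (norm_nonneg _).trans (hC 0 (by simp [hρ0.le]))
  refine ⟨M + C, fun y => ?_⟩
  have hlow : -(C + ε * ‖y‖) ≤ w y := by
    by_cases hy : ‖y‖ ≤ ρ
    · have := (abs_le.1 (hC y (by simpa using hy))).1
      have : 0 ≤ ε * ‖y‖ := by positivity
      linarith
    · push Not at hy
      have hy0 : 0 < ‖y‖ := hρ0.trans hy
      let y0 : ℂ := (ρ / ‖y‖ : ℝ) • y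
      have hy0n : ‖y0‖ = ρ := by
        simp only [y0]
        rw [norm_smul, Real.norm_of_nonneg (by positivity)]
        field_simp
      have hseg : ∀ x ∈ segment ℝ y0 y, ρ ≤ ‖x‖ := by
        rintro x ⟨a, b, ha, hb, hab, rfl⟩
        have : a • y0 + b • y = (a * (ρ / ‖y‖) + b) • y := by
          simp only [y0, add_smul, mul_smul]
        rw [this, norm_smul, Real.norm_of_nonneg (by positivity)]
        have e : (a * (ρ / ‖y‖) + b) * ‖y‖ = a * ρ + b * ‖y‖ := by field_simp
        rw [e]
        nlinarith
      have := (convex_segment y0 y).norm_image_sub_le_of_norm_fderiv_le (𝕜 := ℝ) (f := w) (C := ε)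
        (fun x _ => (hw x).differentiableAt)
        (fun x hx => by
          have h1 := hR ((le_max_left R 1).trans (hseg x hx))
          have h2 := hwn x
          linarith) (left_mem_segment ℝ y0 y) (right_mem_segment ℝ y0 y)
      have h1 := (abs_le.1 this).1
      have h2 := (abs_le.1 (hC y0 (by simp [hy0n]))).1
      have h3 : ‖y - y0‖ ≤ ‖y‖ := by
        have e : y - y0 = (1 - ρ / ‖y‖) • y := by simp only [y0, sub_smul, one_smul]
        have h4 : ρ / ‖y‖ ≤ 1 := by rw [div_le_one hy0]; exact hy.le
        have h5 : 0 ≤ ρ / ‖y‖ := by positivity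
        rw [e, norm_smul, Real.norm_of_nonneg (by linarith)]
        nlinarith
      have h4 : ε * ‖y - y0‖ ≤ ε * ‖y‖ := by gcongr
      linarith
  have := hM y
  simp only [w] at hlow
  linarith

/-- Asymptotics of the gradient of a function that is bounded above and has an integrable
Laplacian of decay `o(|z|⁻²)`. -/
theorem tendsto_mul_dz {v : ℂ → ℝ} (hv : ContDiff ℝ 3 v) {M : ℝ} (hM : ∀ z, v z ≤ M)
    (hi : Integrable (dzb (dz fun w => (v w : ℂ))))
    (hdec : Tendsto (fun z => ‖z‖ ^ 2 * ‖dzb (dz fun w => (v w : ℂ)) z‖)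
      (Bornology.cobounded ℂ) (𝓝 0)) :
    Tendsto (fun z => z * dz (fun w => (v w : ℂ)) z) (Bornology.cobounded ℂ)
      (𝓝 ((π : ℂ)⁻¹ * ∫ z, dzb (dz fun w => (v w : ℂ)) z)) := by
  have hV : ContDiff ℝ 3 fun w => (v w : ℂ) := Complex.ofRealCLM.contDiff.comp hv
  have hp : ContDiff ℝ 2 (dz fun w => (v w : ℂ)) := contDiff_dz hV (by norm_num)
  have hg : ContDiff ℝ 1 (dzb (dz fun w => (v w : ℂ))) := contDiff_dzb hp (by norm_num)
  have hE := differentiable_sub_cauchyT (hp.of_le (by norm_num)) hg hi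
  have ht := tendsto_mul_cauchyT hg.continuous hi hdec
  have h0 := eq_zero_of_bddAbove (hv.of_le (by norm_num)) hM hE (by
    have := ht.mul (tendsto_inv₀_cobounded (α := ℂ))
    rw [mul_zero] at this
    refine this.congr' ?_
    filter_upwards [tendsto_norm_cobounded_atTop.eventually_gt_atTop 0] with z hz
    have z0 : z ≠ 0 := norm_pos_iff.1 hz
    field_simp
    ring)
  refine ht.congr fun z => ?_
  rw [sub_eq_zero.1 (h0 z)]

/-- Comparison of the logarithmic growth along the real axis. -/
theorem re_limit_le {v : ℂ → ℝ} (hv : ContDiff ℝ 1 v) {c : ℂ} {k K : ℝ}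
    (hc : Tendsto (fun z => z * dz (fun w => (v w : ℂ)) z) (Bornology.cobounded ℂ) (𝓝 c))
    (hb : ∀ᶠ z in Bornology.cobounded ℂ, v z + k * Real.log ‖z‖ ≤ K) : 2 * c.re + k ≤ 0 := by
  by_contra! hpos
  set d := (2 * c.re + k) / 2 with hd
  have hd0 : 0 < d := by positivity
  have hre : Tendsto (fun z => 2 * (z * dz (fun w => (v w : ℂ)) z).re) (Bornology.cobounded ℂ)
      (𝓝 (2 * c.re)) := ((Complex.continuous_re.tendsto c).comp hc).const_mul 2
  have hray : Tendsto (fun r : ℝ => (r : ℂ)) atTop (Bornology.cobounded ℂ) := by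
    rw [← tendsto_norm_atTop_iff_cobounded]
    simpa using tendsto_abs_atTop_atTop
  obtain ⟨r0, hr0⟩ := eventually_atTop.1 ((hray.eventually
    ((hre.eventually (lt_mem_nhds (show 2 * c.re - d < 2 * c.re by linarith))).and hb)).and
    (eventually_gt_atTop 0))
  have h0 : 0 < r0 := (hr0 r0 le_rfl).2
  let f : ℝ → ℝ := fun r => v r + (k - d) * Real.log r
  have hf : ∀ r, r0 ≤ r → HasDerivAt f (fderiv ℝ v r 1 + (k - d) * r⁻¹) r := by
    intro r hr
    have h1 : HasDerivAt (fun r : ℝ => v r) (fderiv ℝ v r 1) r :=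
      ((hv.differentiable one_ne_zero) (r : ℂ)).hasFDerivAt.comp_hasDerivAt r
        (Complex.ofRealCLM.hasDerivAt)
    exact h1.add ((Real.hasDerivAt_log (h0.trans_le hr).ne').const_mul _)
  have hmono : MonotoneOn f (Set.Ici r0) := by
    refine monotoneOn_of_deriv_nonneg (convex_Ici _)
      (fun r hr => (hf r hr).continuousAt.continuousWithinAt)
      (fun r hr => (hf r (interior_subset hr)).differentiableAt.differentiableWithinAt)
      (fun r hr => ?_)
    have hr' : r0 ≤ r := interior_subset hr
    have hrp : 0 < r := h0.trans_le hr'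
    rw [(hf r hr').deriv, fderiv_real_apply ((hv.differentiable one_ne_zero) _), mul_one]
    have h1 := (hr0 r hr').1.1
    rw [Complex.re_ofReal_mul] at h1
    have h2 : 0 ≤ r * (2 * (dz (fun w => (v w : ℂ)) r).re + (k - d) * r⁻¹) := by
      have : r * (2 * (dz (fun w => (v w : ℂ)) r).re + (k - d) * r⁻¹) =
        2 * (r * (dz (fun w => (v w : ℂ)) r).re) + (k - d) := by field_simp
      rw [this]; linarith
    exact nonneg_of_mul_nonneg_right h2 hrp
  obtain ⟨r, hr1, hr2⟩ := ((Real.tendsto_log_atTop.const_mul_atTop hd0).eventually_gt_atTop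
    (K - f r0)).and (eventually_ge_atTop r0) |>.exists
  have h1 := hmono (Set.mem_Ici.2 le_rfl) (Set.mem_Ici.2 hr2) hr2
  have h2 := (hr0 r hr2).1.2
  rw [Complex.norm_real, Real.norm_of_nonneg (h0.le.trans hr2)] at h2
  simp only [f] at h1 hr1
  nlinarith

theorem fderiv_clm_comp {f : ℂ → ℂ} (L : ℂ →L[ℝ] ℂ) {z : ℂ} (hf : DifferentiableAt ℝ f z) :
    fderiv ℝ (fun w => L (f w)) z = L ∘L fderiv ℝ f z :=
  (L.hasFDerivAt.comp z hf.hasFDerivAt).fderiv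

theorem dzb_dz_clm_comp {f : ℂ → ℂ} (L : ℂ →L[ℝ] ℂ) (hf : ContDiff ℝ 2 f) (z : ℂ) :
    dzb (dz fun w => L (f w)) z = L (dzb (dz f) z) := by
  have h : ∀ a b : ℂ, fderiv ℝ (fun y => fderiv ℝ (fun w => L (f w)) y a) z b =
      L (fderiv ℝ (fun y => fderiv ℝ f y a) z b) := by
    intro a b
    have e : (fun y => fderiv ℝ (fun w => L (f w)) y a) = fun y => L (fderiv ℝ f y a) := by
      funext y
      rw [fderiv_clm_comp L (hf.differentiable two_ne_zero y)]
      rfl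
    rw [e, fderiv_clm_comp L]
    · rfl
    · exact ((contDiff_fderiv_apply hf (m := 1) (by norm_num) a).differentiable one_ne_zero) z
  rw [(dzb_dz_eq (f := fun w => L (f w)) (L.contDiff.comp hf) z).1, (dzb_dz_eq hf z).1, h, h,
    ← map_add]
  have : ∀ x : ℂ, x / 4 = (4⁻¹ : ℝ) • x := by intro x; simp; ring
  rw [this, this, map_smul]

theorem dzb_dz_ofReal {v : ℂ → ℝ} (hv : ContDiff ℝ 2 v) (z : ℂ) :
    dzb (dz fun w => (v w : ℂ)) z = ((lapC v z / 4 : ℝ) : ℂ) := by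
  have h1 : ∀ {g : ℂ → ℝ} {y : ℂ}, DifferentiableAt ℝ g y →
      fderiv ℝ (fun w => (g w : ℂ)) y = Complex.ofRealCLM ∘L fderiv ℝ g y := fun hg =>
    (Complex.ofRealCLM.hasFDerivAt.comp _ hg.hasFDerivAt).fderiv
  have h : ∀ a b : ℂ, fderiv ℝ (fun y => fderiv ℝ (fun w => (v w : ℂ)) y a) z b =
      ((fderiv ℝ (fun y => fderiv ℝ v y a) z b : ℝ) : ℂ) := by
    intro a b
    have e : (fun y => fderiv ℝ (fun w => (v w : ℂ)) y a) =
        fun y => ((fderiv ℝ v y a : ℝ) : ℂ) := by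
      funext y
      rw [h1 (hv.differentiable two_ne_zero y)]
      rfl
    have hd : ContDiff ℝ 1 fun y => fderiv ℝ v y a :=
      (hv.fderiv_right (m := 1) (by norm_num)).clm_apply contDiff_const
    rw [e, h1 (hd.differentiable one_ne_zero z)]
    rfl
  rw [(dzb_dz_eq (f := fun w => (v w : ℂ)) (Complex.ofRealCLM.contDiff.comp hv) z).1, h, h, lapC]
  push_cast
  rfl

theorem tendsto_mul_dz_lap {v : ℂ → ℝ} (hv : ContDiff ℝ 3 v) {M : ℝ} (hM : ∀ z, v z ≤ M)
    {e : ℂ → ℝ} (he : Integrable e)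
    (hdec : Tendsto (fun z => ‖z‖ ^ 2 * e z) (Bornology.cobounded ℂ) (𝓝 0))
    (hle : ∀ z, z ≠ 0 → |lapC v z| ≤ e z) :
    Tendsto (fun z => z * dz (fun w => (v w : ℂ)) z) (Bornology.cobounded ℂ)
      (𝓝 (((4 * π)⁻¹ * ∫ z, lapC v z : ℝ) : ℂ)) := by
  have hv2 : ContDiff ℝ 2 v := hv.of_le (by norm_num)
  have hl : Integrable (lapC v) := by
    refine he.mono' (continuous_lapC hv2).aestronglyMeasurable ?_
    filter_upwards [compl_mem_ae_iff.2 (measure_singleton (0 : ℂ))] with z hz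
    exact hle z hz
  have e1 : dzb (dz fun w => (v w : ℂ)) = fun z => ((lapC v z / 4 : ℝ) : ℂ) :=
    funext (dzb_dz_ofReal hv2)
  have := tendsto_mul_dz hv hM (by rw [e1]; exact (hl.div_const 4).ofReal) (by
    refine squeeze_zero' (Eventually.of_forall fun z => by positivity) ?_ hdec
    filter_upwards [tendsto_norm_cobounded_atTop.eventually_gt_atTop 0] with z hz
    gcongr
    rw [e1, Complex.norm_real, Real.norm_eq_abs, abs_div]
    have := hle z (norm_pos_iff.1 hz)
    have := abs_nonneg (lapC v z)
    norm_num
    linarith)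
  convert this using 2
  have e2 : ∫ z, dzb (dz fun w => (v w : ℂ)) z = (((∫ z, lapC v z) / 4 : ℝ) : ℂ) := by
    rw [e1, ← integral_div]
    exact integral_ofReal
  rw [e2, ← Complex.ofReal_inv, ← Complex.ofReal_mul]
  congr 1
  field_simp

theorem tendsto_mul_dz_zero_real {v : ℂ → ℝ} (hv : ContDiff ℝ 3 v) {M : ℝ} (hM : ∀ z, |v z| ≤ M)
    {e : ℂ → ℝ} (he : Integrable e)
    (hdec : Tendsto (fun z => ‖z‖ ^ 2 * e z) (Bornology.cobounded ℂ) (𝓝 0))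
    (hle : ∀ z, z ≠ 0 → |lapC v z| ≤ e z) :
    Tendsto (fun z => z * dz (fun w => (v w : ℂ)) z) (Bornology.cobounded ℂ) (𝓝 0) := by
  have ht := tendsto_mul_dz_lap hv (fun z => (abs_le.1 (hM z)).2) he hdec hle
  set c := (4 * π)⁻¹ * ∫ z, lapC v z
  have hv1 : ContDiff ℝ 1 v := hv.of_le (by norm_num)
  have h1 := re_limit_le hv1 (k := 0) (K := M) ht
    (Eventually.of_forall fun z => by simpa using (abs_le.1 (hM z)).2)
  have hV : ContDiff ℝ 1 fun w => (v w : ℂ) := Complex.ofRealCLM.contDiff.comp hv1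
  have hn : Tendsto (fun z => z * dz (fun w => ((-v w : ℝ) : ℂ)) z) (Bornology.cobounded ℂ)
      (𝓝 (-(c : ℂ))) := by
    refine ht.neg.congr fun z => ?_
    have : (fun w => ((-v w : ℝ) : ℂ)) = fun w => 0 - (v w : ℂ) := by
      funext w; simp
    rw [this, dz_sub (differentiableAt_const _) (hV.differentiable one_ne_zero z), dz_const]
    ring
  have h2 := re_limit_le hv1.neg (k := 0) (K := M) hn
    (Eventually.of_forall fun z => by
      have := (abs_le.1 (hM z)).1
      simp only [zero_mul, add_zero]; linarith)
  simp only [Complex.neg_re, Complex.ofReal_re] at h1 h2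
  have hc : c = 0 := by linarith
  simpa [hc] using ht

/-- A bounded function whose Laplacian is integrable with decay `o(|z|⁻²)` has vanishing
logarithmic gradient at infinity. -/
theorem tendsto_mul_dz_zero {f : ℂ → ℂ} (hf : ContDiff ℝ 3 f) {M : ℝ} (hM : ∀ z, ‖f z‖ ≤ M)
    {e : ℂ → ℝ} (he : Integrable e)
    (hdec : Tendsto (fun z => ‖z‖ ^ 2 * e z) (Bornology.cobounded ℂ) (𝓝 0))
    (hle : ∀ z, z ≠ 0 → ‖dzb (dz f) z‖ ≤ e z) :
    Tendsto (fun z => z * dz f z) (Bornology.cobounded ℂ) (𝓝 0) := by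
  have hf2 : ContDiff ℝ 2 f := hf.of_le (by norm_num)
  have key : ∀ L : ℂ →L[ℝ] ℝ, (∀ w, |L w| ≤ ‖w‖) →
      Tendsto (fun z => z * dz (fun w => (L (f w) : ℂ)) z) (Bornology.cobounded ℂ) (𝓝 0) := by
    intro L hL
    have hLf : ContDiff ℝ 3 fun w => L (f w) := L.contDiff.comp hf
    refine tendsto_mul_dz_zero_real hLf (fun z => (hL _).trans (hM z))
      (he.const_mul 4) (by simpa [mul_left_comm] using hdec.const_mul 4) fun z hz => ?_
    have h1 := dzb_dz_ofReal (hLf.of_le (by norm_num)) z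
    have h2 := dzb_dz_clm_comp (Complex.ofRealCLM ∘L L) hf2 z
    have h3 : ((lapC (fun w => L (f w)) z / 4 : ℝ) : ℂ) = ((L (dzb (dz f) z) : ℝ) : ℂ) :=
      h1.symm.trans h2
    have h4 := Complex.ofReal_injective h3
    have h5 := (hL (dzb (dz f) z)).trans (hle z hz)
    rw [← h4, abs_div, abs_of_pos (show (0 : ℝ) < 4 by norm_num)] at h5
    linarith
  have hre := key Complex.reCLM Complex.abs_re_le_norm
  have him := key Complex.imCLM Complex.abs_im_le_norm
  have h := hre.add (him.const_mul Complex.I)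
  simp only [mul_zero, add_zero] at h
  refine h.congr fun z => ?_
  have d1 : DifferentiableAt ℝ (fun w => ((Complex.reCLM (f w) : ℝ) : ℂ)) z :=
    ((Complex.ofRealCLM.contDiff.comp (Complex.reCLM.contDiff.comp hf2)).differentiable
      two_ne_zero) z
  have d2 : DifferentiableAt ℝ (fun w => ((Complex.imCLM (f w) : ℝ) : ℂ)) z :=
    ((Complex.ofRealCLM.contDiff.comp (Complex.imCLM.contDiff.comp hf2)).differentiable
      two_ne_zero) z
  have e1 : f = fun w => ((Complex.reCLM (f w) : ℝ) : ℂ) +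
      Complex.I * ((Complex.imCLM (f w) : ℝ) : ℂ) := by
    funext w
    rw [mul_comm]
    exact (Complex.re_add_im (f w)).symm
  conv_rhs => rw [e1]
  rw [dz_add (g := fun w => Complex.I * ((Complex.imCLM (f w) : ℝ) : ℂ)) d1
    ((differentiableAt_const _).mul d2), dz_mul (differentiableAt_const _) d2, dz_const]
  ring

theorem contDiff_succ_of_lapC {v : ℂ → ℝ} (hv : ContDiff ℝ 2 v) {n : ℕ} (hn : 1 ≤ n)
    (hl : ContDiff ℝ n (lapC v)) : ContDiff ℝ (n + 1 : ℕ) v := by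
  have hV : ContDiff ℝ 2 fun w => (v w : ℂ) := Complex.ofRealCLM.contDiff.comp hv
  have hp : ContDiff ℝ n (dz fun w => (v w : ℂ)) := by
    refine contDiff_of_dzb (n := n) (by exact_mod_cast hn) (contDiff_dz hV (by norm_num)) ?_
    rw [funext (dzb_dz_ofReal hv)]
    exact Complex.ofRealCLM.contDiff.comp (hl.div_const 4)
  have e : fderiv ℝ v = fun z => Complex.reCLM ∘L
      (ContinuousLinearMap.mul ℝ ℂ (2 * dz (fun w => (v w : ℂ)) z)) := by
    funext z
    ext h
    rw [fderiv_real_apply (hv.differentiable two_ne_zero z)]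
    simp [mul_assoc]
  push_cast
  refine contDiff_succ_iff_fderiv.2 ⟨hv.differentiable two_ne_zero, by simp, ?_⟩
  rw [e]
  exact contDiff_const.clm_comp
    ((ContinuousLinearMap.mul ℝ ℂ).contDiff.comp (contDiff_const.mul hp))

theorem contDiff_infty_of_toda {v1 v2 : ℂ → ℝ} (h1 : ContDiff ℝ 2 v1) (h2 : ContDiff ℝ 2 v2)
    (e1 : ∀ z, lapC v1 z = -2 * exp (v1 z) + exp (v2 z))
    (e2 : ∀ z, lapC v2 z = 2 * exp (v1 z) - 2 * exp (v2 z)) :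
    ContDiff ℝ ∞ v1 ∧ ContDiff ℝ ∞ v2 := by
  have key : ∀ n : ℕ, ContDiff ℝ (n + 2 : ℕ) v1 ∧ ContDiff ℝ (n + 2 : ℕ) v2 := by
    intro n
    induction n with
    | zero => exact ⟨by exact_mod_cast h1, by exact_mod_cast h2⟩
    | succ n ih =>
      refine ⟨contDiff_succ_of_lapC h1 (n := n + 2) (by omega) ?_,
        contDiff_succ_of_lapC h2 (n := n + 2) (by omega) ?_⟩
      · rw [funext e1]
        exact (contDiff_const.mul ih.1.exp).add ih.2.exp
      · rw [funext e2]
        exact (contDiff_const.mul ih.1.exp).sub (contDiff_const.mul ih.2.exp)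
  exact ⟨contDiff_infty.2 fun n => (key n).1.of_le (by exact_mod_cast Nat.le_add_right n 2),
    contDiff_infty.2 fun n => (key n).2.of_le (by exact_mod_cast Nat.le_add_right n 2)⟩

section Algebra

variable {R : Type*} [CommRing R] [Algebra ℂ R] (D Db : Derivation ℂ R R) {A B X Y : R}

theorem quadratic_invariant (hc : ∀ f, Db (D f) = D (Db f)) (hA : Db A = -X) (hB : Db B = X - Y)
    (hX : D X = X * (1 + A - B)) (hY : D Y = Y * (1 + 2 * B)) :
    Db (3 * (D A - A) - A * A + (D B - B) - B * B) = 0 := by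
  have h3 : Db (3 : R) = 0 := by exact_mod_cast Db.map_natCast 3
  simp only [map_add, map_sub, Derivation.leibniz, hc, hA, hB, hX, hY, h3, map_neg, smul_eq_mul]
  ring

theorem quartic_invariant (hc : ∀ f, Db (D f) = D (Db f)) (hA : Db A = -X)
    (hX : D X = X * (1 + A - B)) {P1 P2 P3 : R}
    (hP1 : P1 = D A - A - A * A) (hP2 : P2 = D P1 - 2 * P1 - A * P1)
    (hP3 : P3 = D P2 - 3 * P2 - A * P2)
    (hΩ : 3 * (D A - A) - A * A + (D B - B) - B * B = 0) : Db P3 = 0 := by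
  have h2 : Db (2 : R) = 0 := by exact_mod_cast Db.map_natCast 2
  have h3 : Db (3 : R) = 0 := by exact_mod_cast Db.map_natCast 3
  have k2 : D (2 : R) = 0 := by exact_mod_cast D.map_natCast 2
  have e1 : Db P1 = X * (A + B) := by
    rw [hP1]
    simp only [map_sub, Derivation.leibniz, hc, hA, hX, map_neg, smul_eq_mul]
    ring
  have e2 : Db P2 = -(X * (D A - A + A * B)) := by
    rw [hP2]
    simp only [map_add, map_sub, Derivation.leibniz, hc, hA, hX, smul_eq_mul, e1, h2]
    rw [hP1]
    linear_combination X * hΩ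
  rw [hP3]
  simp only [map_add, map_sub, map_neg, Derivation.leibniz, hc, hA, hX, smul_eq_mul, e2, h3]
  rw [hP2, hP1]
  simp only [map_sub, Derivation.leibniz, smul_eq_mul]
  linear_combination (-X * A) * hΩ

end Algebra

/-- The algebra of smooth functions on the plane. -/
def Sm : Subalgebra ℂ (ℂ → ℂ) where
  carrier := {f | ContDiff ℝ ∞ f}
  mul_mem' := fun hf hg => Set.mem_ofPred.2 ((Set.mem_ofPred.1 hf).mul (Set.mem_ofPred.1 hg))
  add_mem' := fun hf hg => Set.mem_ofPred.2 ((Set.mem_ofPred.1 hf).add (Set.mem_ofPred.1 hg))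
  algebraMap_mem' := fun _ => Set.mem_ofPred.2 contDiff_const

/-- A smooth function as an element of the algebra `Sm`. -/
def toSm (f : ℂ → ℂ) (hf : ContDiff ℝ ∞ f) : Sm := ⟨f, Set.mem_ofPred.2 hf⟩

theorem contDiff_coe (f : Sm) : ContDiff ℝ ∞ f.1 := Set.mem_ofPred.1 f.2

theorem differentiable_coe (f : Sm) : Differentiable ℝ f.1 :=
  (contDiff_coe f).differentiable (by simp)

/-- `∂̄` as a derivation of the algebra of smooth functions. -/
def Dbar : Derivation ℂ Sm Sm :=
  Derivation.mk'
    { toFun := fun f => toSm (dzb f) (contDiff_dzb (contDiff_coe f) (by simp))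
      map_add' := fun f g => Subtype.ext <| funext fun z => dzb_add (differentiable_coe f z)
          (differentiable_coe g z)
      map_smul' := fun c f => Subtype.ext <| funext fun z => by
        have := dzb_mul (differentiableAt_const (𝕜 := ℝ) c) (differentiable_coe f z)
        rw [dzb_const, mul_zero, add_zero] at this
        exact this }
    fun f g => Subtype.ext <| funext fun z => dzb_mul (differentiable_coe f z)
      (differentiable_coe g z)

/-- The derivation `z∂` of the algebra of smooth functions. -/
def Eul : Derivation ℂ Sm Sm :=
  Derivation.mk'
    { toFun := fun f => toSm (fun z => z * dz f z)
        (contDiff_id.mul (contDiff_dz (contDiff_coe f) (by simp)))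
      map_add' := fun f g => Subtype.ext <| funext fun z => by
        have := dz_add (differentiable_coe f z) (differentiable_coe g z)
        change z * dz (fun w => f.1 w + g.1 w) z = z * dz f.1 z + z * dz g.1 z
        rw [this]; ring
      map_smul' := fun c f => Subtype.ext <| funext fun z => by
        have := dz_mul (differentiableAt_const (𝕜 := ℝ) c) (differentiable_coe f z)
        change z * dz (fun w => c * f.1 w) z = c * (z * dz f.1 z)
        rw [this, dz_const]; ring }
    fun f g => Subtype.ext <| funext fun z => by
      have := dz_mul (differentiable_coe f z) (differentiable_coe g z)
      change z * dz (fun w => f.1 w * g.1 w) z = f.1 z * (z * dz g.1 z) + g.1 z * (z * dz f.1 z)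
      rw [this]; ring

theorem Dbar_apply (f : Sm) (z : ℂ) : (Dbar f).1 z = dzb f.1 z := rfl

theorem Eul_apply (f : Sm) (z : ℂ) : (Eul f).1 z = z * dz f.1 z := rfl

theorem Dbar_Eul_apply (f : Sm) (z : ℂ) : (Dbar (Eul f)).1 z = z * dzb (dz f.1) z := by
  have hd : Differentiable ℝ (dz f.1) :=
    (contDiff_dz (m := 1) (contDiff_coe f) (by norm_cast)).differentiable one_ne_zero
  have := dzb_mul (f := fun w => w) differentiableAt_id (hd z)
  change dzb (fun w => w * dz f.1 w) z = _
  rw [this, dzb_id]; ring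

theorem Dbar_Eul (f : Sm) : Dbar (Eul f) = Eul (Dbar f) :=
  Subtype.ext <| funext fun z => by
    rw [Dbar_Eul_apply, dzb_dz_comm ((contDiff_coe f).of_le (by norm_cast))]
    rfl

/-- Boundedness of a smooth function. -/
def Bd (f : Sm) : Prop := ∃ C : ℝ, ∀ z, ‖f.1 z‖ ≤ C

theorem Bd.add {f g : Sm} (hf : Bd f) (hg : Bd g) : Bd (f + g) := by
  obtain ⟨C, hC⟩ := hf
  obtain ⟨C', hC'⟩ := hg
  exact ⟨C + C', fun z => (norm_add_le _ _).trans (add_le_add (hC z) (hC' z))⟩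

theorem Bd.neg {f : Sm} (hf : Bd f) : Bd (-f) := by
  obtain ⟨C, hC⟩ := hf
  exact ⟨C, fun z => (norm_neg (f.1 z)).trans_le (hC z)⟩

theorem Bd.sub {f g : Sm} (hf : Bd f) (hg : Bd g) : Bd (f - g) := by
  rw [sub_eq_add_neg]; exact hf.add hg.neg

theorem Bd.mul {f g : Sm} (hf : Bd f) (hg : Bd g) : Bd (f * g) := by
  obtain ⟨C, hC⟩ := hf
  obtain ⟨C', hC'⟩ := hg
  refine ⟨C * C', fun z => (norm_mul_le _ _).trans ?_⟩
  exact mul_le_mul (hC z) (hC' z) (norm_nonneg _) ((norm_nonneg _).trans (hC z))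

theorem Bd.one : Bd 1 := ⟨1, fun z => by simp⟩

theorem Bd.natCast (n : ℕ) : Bd n := ⟨n, fun z => by simp⟩

theorem Bd.of_tendsto {f : Sm} {c : ℂ} (h : Tendsto f.1 (Bornology.cobounded ℂ) (𝓝 c)) : Bd f := by
  obtain ⟨R, -, hR⟩ := (hasBasis_cobounded_norm (E := ℂ)).eventually_iff.1
    (h.norm.eventually (gt_mem_nhds (lt_add_one ‖c‖)))
  obtain ⟨C, hC⟩ := (isCompact_closedBall (0 : ℂ) R).exists_bound_of_continuousOn
    (contDiff_coe f).continuous.continuousOn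
  refine ⟨max C (‖c‖ + 1), fun z => ?_⟩
  rcases le_total ‖z‖ R with hz | hz
  · exact (hC z (by simpa using hz)).trans (le_max_left _ _)
  · exact (hR hz).le.trans (le_max_right _ _)

/-- Liouville's theorem, together with the value at infinity. -/
theorem eq_zero_of_Dbar_eq_zero {f : Sm} (hf : Dbar f = 0) (hb : Bd f) (h0 : f.1 0 = 0) :
    f = 0 := by
  have hd : Differentiable ℂ f.1 := fun z =>
    differentiableAt_of_dzb_eq_zero (differentiable_coe f z) (by rw [← Dbar_apply, hf]; rfl)
  obtain ⟨C, hC⟩ := hb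
  refine Subtype.ext <| funext fun z => ?_
  have := hd.apply_eq_apply_of_bounded
    (isBounded_iff_forall_norm_le.2 ⟨C, by rintro _ ⟨w, rfl⟩; exact hC w⟩) z 0
  rw [this, h0]; rfl

/-- A smooth real function, as an element of `Sm`. -/
def ofR (v : ℂ → ℝ) (hv : ContDiff ℝ ∞ v) : Sm :=
  toSm (fun z => (v z : ℂ)) (Complex.ofRealCLM.contDiff.comp hv)

/-- The smooth function `z exp(v) / 4`. -/
def wexp (v : ℂ → ℝ) (hv : ContDiff ℝ ∞ v) : Sm :=
  toSm (fun z => z * Complex.exp (v z) / 4)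
    ((contDiff_id.mul (Complex.ofRealCLM.contDiff.comp hv).cexp).div_const 4)

theorem Eul_wexp (v : ℂ → ℝ) (hv : ContDiff ℝ ∞ v) :
    Eul (wexp v hv) = wexp v hv * (1 + Eul (ofR v hv)) := by
  refine Subtype.ext <| funext fun z => ?_
  have hd : DifferentiableAt ℝ (fun w => (v w : ℂ)) z := differentiable_coe (ofR v hv) z
  have h1 := dz_mul (f := fun w => w) (differentiableAt_id (𝕜 := ℝ) (x := z)) hd.cexp
  have h2 := dz_mul (f := fun _ => (4 : ℂ)⁻¹) (differentiableAt_const (𝕜 := ℝ) (x := z) _)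
    (differentiableAt_id.mul hd.cexp)
  rw [dz_const] at h2
  have h3 : dz (fun w => w * Complex.exp (v w) / 4) z =
      (4 : ℂ)⁻¹ * dz (fun w => w * Complex.exp (v w)) z := by
    rw [show (fun w => w * Complex.exp (v w) / 4) = fun w => (4 : ℂ)⁻¹ * (w * Complex.exp (v w)) by
      funext w; ring]
    refine h2.trans ?_
    rw [mul_zero, add_zero]; rfl
  change z * dz (fun w => w * Complex.exp (v w) / 4) z =
    z * Complex.exp (v z) / 4 * (1 + z * dz (fun w => (v w : ℂ)) z)
  rw [h3, h1, dz_id, dz_cexp hd]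
  ring

theorem norm_wexp (v : ℂ → ℝ) (hv : ContDiff ℝ ∞ v) (z : ℂ) :
    ‖(wexp v hv).1 z‖ = ‖z‖ * exp (v z) / 4 := by
  change ‖z * Complex.exp (v z) / 4‖ = _
  rw [norm_div, norm_mul, Complex.norm_exp, Complex.ofReal_re]
  norm_num

section

variable {v1 v2 : ℂ → ℝ} {h1 : ContDiff ℝ ∞ v1} {h2 : ContDiff ℝ ∞ v2}

theorem tendsto_Eul_zero
    (i1 : Integrable fun z => exp (v1 z)) (i2 : Integrable fun z => exp (v2 z))
    (d1 : Tendsto (fun z => ‖z‖ ^ 2 * exp (v1 z)) (Bornology.cobounded ℂ) (𝓝 0))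
    (d2 : Tendsto (fun z => ‖z‖ ^ 2 * exp (v2 z)) (Bornology.cobounded ℂ) (𝓝 0))
    {f g h : Sm} (hf : Bd f) (hg : Bd g) (hh : Bd h)
    (he : Dbar (Eul f) = wexp v1 h1 * g + wexp v2 h2 * h) :
    Tendsto (Eul f).1 (Bornology.cobounded ℂ) (𝓝 0) := by
  obtain ⟨C, hC⟩ := hf
  obtain ⟨C1, hC1⟩ := hg
  obtain ⟨C2, hC2⟩ := hh
  refine tendsto_mul_dz_zero ((contDiff_coe f).of_le (by norm_cast)) hC
    (e := fun z => C1 * exp (v1 z) + C2 * exp (v2 z)) ((i1.const_mul _).add (i2.const_mul _)) ?_ ?_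
  · have := (d1.const_mul C1).add (d2.const_mul C2)
    simp only [mul_zero, add_zero] at this
    refine this.congr fun z => ?_
    ring
  · intro z hz
    have hz0 : 0 < ‖z‖ := norm_pos_iff.2 hz
    have e1 : z * dzb (dz f.1) z = (wexp v1 h1).1 z * g.1 z + (wexp v2 h2).1 z * h.1 z := by
      rw [← Dbar_Eul_apply, he]; rfl
    have e2 : ‖z‖ * ‖dzb (dz f.1) z‖ ≤ ‖z‖ * exp (v1 z) / 4 * C1 + ‖z‖ * exp (v2 z) / 4 * C2 := by
      rw [← norm_mul, e1]
      refine (norm_add_le _ _).trans ?_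
      rw [norm_mul, norm_mul, norm_wexp, norm_wexp]
      gcongr
      · exact hC1 z
      · exact hC2 z
    have c1 : 0 ≤ C1 * exp (v1 z) := mul_nonneg ((norm_nonneg _).trans (hC1 z)) (exp_pos _).le
    have c2 : 0 ≤ C2 * exp (v2 z) := mul_nonneg ((norm_nonneg _).trans (hC2 z)) (exp_pos _).le
    refine le_of_mul_le_mul_left ?_ hz0
    have c3 : 0 ≤ ‖z‖ * (C1 * exp (v1 z) + C2 * exp (v2 z)) := by positivity
    linarith

end

theorem bddAbove_of_tendsto {v : ℂ → ℝ} (hv : Continuous v)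
    (hd : Tendsto (fun z => ‖z‖ ^ 2 * exp (v z)) (Bornology.cobounded ℂ) (𝓝 0)) :
    (∃ M, ∀ z, v z ≤ M) ∧ ∀ᶠ z in Bornology.cobounded ℂ, v z + 2 * Real.log ‖z‖ ≤ 0 := by
  have hev : ∀ᶠ z in Bornology.cobounded ℂ, v z + 2 * Real.log ‖z‖ ≤ 0 := by
    filter_upwards [hd.eventually (gt_mem_nhds one_pos),
      tendsto_norm_cobounded_atTop.eventually_gt_atTop 0] with z hz hz0
    have := Real.log_le_log (by positivity) hz.le
    rw [Real.log_mul (by positivity) (exp_pos _).ne', Real.log_exp, Real.log_one,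
      Real.log_pow] at this
    push_cast at this
    linarith
  refine ⟨?_, hev⟩
  obtain ⟨R, -, hR⟩ := (hasBasis_cobounded_norm (E := ℂ)).eventually_iff.1
    (hev.and (tendsto_norm_cobounded_atTop.eventually_ge_atTop 1))
  obtain ⟨C, hC⟩ := (isCompact_closedBall (0 : ℂ) R).exists_bound_of_continuousOn hv.continuousOn
  refine ⟨max C 0, fun z => ?_⟩
  rcases le_total ‖z‖ R with hz | hz
  · exact ((le_abs_self _).trans (hC z (by simpa using hz))).trans (le_max_left _ _)
  · have h := hR hz
    have := Real.log_nonneg h.2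
    exact le_trans (by linarith [h.1]) (le_max_right _ _)

theorem energy_of_relations {a b : ℝ} (ha : a < 0) (hab : 2 * (a - b) + 2 ≤ 0)
    (hb : 2 * (2 * b) + 2 ≤ 0) (hq : 3 * a + a ^ 2 + b + b ^ 2 = 0)
    (h4 : a * (a + 1) * (a + 2) * (a + 3) = 0) : a = -3 ∧ b = -1 := by
  have h12 : a ≠ -1 := by
    rintro rfl
    have : (b - 1) * (b + 2) = 0 := by linarith
    rcases mul_eq_zero.1 this with h | h <;> linarith
  have h13 : a ≠ -2 := by
    rintro rfl
    have : (b - 1) * (b + 2) = 0 := by linarith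
    rcases mul_eq_zero.1 this with h | h <;> linarith
  have h3 : a = -3 := by
    simp only [mul_eq_zero] at h4
    rcases h4 with ((h | h) | h) | h
    · exact absurd h ha.ne
    · exact absurd (by linarith) h12
    · exact absurd (by linarith) h13
    · linarith
  subst h3
  have : b * (b + 1) = 0 := by linarith
  rcases mul_eq_zero.1 this with h | h
  · linarith
  · exact ⟨rfl, by linarith⟩

theorem energy_plane {v1 v2 : ℂ → ℝ} (hv1 : ContDiff ℝ 2 v1) (hv2 : ContDiff ℝ 2 v2)
    (e1 : ∀ z, lapC v1 z = -2 * exp (v1 z) + exp (v2 z))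
    (e2 : ∀ z, lapC v2 z = 2 * exp (v1 z) - 2 * exp (v2 z))
    (i1 : Integrable fun z => exp (v1 z)) (i2 : Integrable fun z => exp (v2 z)) :
    (∫ z, exp (v1 z)) = 12 * π ∧ (∫ z, exp (v2 z)) = 16 * π := by
  obtain ⟨h1, h2⟩ := contDiff_infty_of_toda hv1 hv2 e1 e2
  have d1 := tendsto_norm_sq_mul_exp hv1
    (fun z => by rw [e1]; have := exp_pos (v2 z); linarith) i1
  have d2 := tendsto_norm_sq_mul_exp hv2
    (fun z => by rw [e2]; have := exp_pos (v1 z); linarith) i2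
  obtain ⟨⟨M1, hM1⟩, l1⟩ := bddAbove_of_tendsto hv1.continuous d1
  obtain ⟨⟨M2, hM2⟩, l2⟩ := bddAbove_of_tendsto hv2.continuous d2
  set I1 := ∫ z, exp (v1 z) with hI1
  set I2 := ∫ z, exp (v2 z) with hI2
  have ie : Integrable fun z => 2 * exp (v1 z) + 2 * exp (v2 z) :=
    (i1.const_mul 2).add (i2.const_mul 2)
  have de : Tendsto (fun z => ‖z‖ ^ 2 * (2 * exp (v1 z) + 2 * exp (v2 z)))
      (Bornology.cobounded ℂ) (𝓝 0) := by
    have := (d1.const_mul 2).add (d2.const_mul 2)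
    simp only [mul_zero, add_zero] at this
    exact this.congr fun z => by ring
  have t1 := tendsto_mul_dz_lap (h1.of_le (by norm_cast)) hM1 ie de (fun z _ => by
    rw [e1, abs_le]; constructor <;> linarith [exp_pos (v1 z), exp_pos (v2 z)])
  have t2 := tendsto_mul_dz_lap (h2.of_le (by norm_cast)) hM2 ie de (fun z _ => by
    rw [e2, abs_le]; constructor <;> linarith [exp_pos (v1 z), exp_pos (v2 z)])
  have L1 : ∫ z, lapC v1 z = -2 * I1 + I2 := by
    simp_rw [e1]
    rw [integral_add (i1.const_mul _) i2, integral_const_mul]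
  have L2 : ∫ z, lapC v2 z = 2 * I1 - 2 * I2 := by
    simp_rw [e2]
    rw [integral_sub (i1.const_mul _) (i2.const_mul _), integral_const_mul, integral_const_mul]
  set a : ℝ := -(4 * π)⁻¹ * I1 with ha
  set b : ℝ := (4 * π)⁻¹ * (I1 - I2) with hb
  have hc1 : (4 * π)⁻¹ * ∫ z, lapC v1 z = a - b := by rw [L1, ha, hb]; ring
  have hc2 : (4 * π)⁻¹ * ∫ z, lapC v2 z = 2 * b := by rw [L2, hb]; ring
  rw [hc1] at t1
  rw [hc2] at t2
  have r1 := re_limit_le (h1.of_le (by norm_cast)) t1 l1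
  have r2 := re_limit_le (h2.of_le (by norm_cast)) t2 l2
  rw [Complex.ofReal_re] at r1 r2
  have hI1pos : 0 < I1 := by
    rw [hI1, integral_pos_iff_support_of_nonneg (fun z => (exp_pos _).le) i1]
    have : (Function.support fun z => exp (v1 z)) = Set.univ :=
      Set.eq_univ_of_forall fun z => (exp_pos _).ne'
    rw [this]; simp
  have ha0 : a < 0 := by
    rw [ha, neg_mul, neg_lt_zero]; positivity
  -- the algebraic data
  let U1 := ofR v1 h1
  let U2 := ofR v2 h2
  let X := wexp v1 h1
  let Y := wexp v2 h2
  let B : Sm := (1 / 2 : ℂ) • Eul U2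
  let A : Sm := Eul U1 + B
  have dU1 : Dbar (Eul U1) = -2 * X + Y := by
    refine Subtype.ext <| funext fun z => ?_
    rw [Dbar_Eul_apply]
    change z * dzb (dz fun w => (v1 w : ℂ)) z =
      -2 * (z * Complex.exp (v1 z) / 4) + z * Complex.exp (v2 z) / 4
    rw [dzb_dz_ofReal hv1, e1]
    push_cast; ring
  have dU2 : Dbar (Eul U2) = 2 * X - 2 * Y := by
    refine Subtype.ext <| funext fun z => ?_
    rw [Dbar_Eul_apply]
    change z * dzb (dz fun w => (v2 w : ℂ)) z =
      2 * (z * Complex.exp (v1 z) / 4) - 2 * (z * Complex.exp (v2 z) / 4)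
    rw [dzb_dz_ofReal hv2, e2]
    push_cast; ring
  have hBU : Eul U2 = 2 * B := by
    refine Subtype.ext <| funext fun z => ?_
    change (Eul U2).1 z = 2 * ((1 / 2 : ℂ) * (Eul U2).1 z)
    ring
  have hB : Dbar B = X - Y := by
    have : Dbar B = (1 / 2 : ℂ) • Dbar (Eul U2) := Dbar.map_smul _ _
    rw [this, dU2]
    refine Subtype.ext <| funext fun z => ?_
    change (1 / 2 : ℂ) * (2 * X.1 z - 2 * Y.1 z) = X.1 z - Y.1 z
    ring
  have hA : Dbar A = -X := by
    have : Dbar A = Dbar (Eul U1) + Dbar B := map_add _ _ _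
    rw [this, dU1, hB]; ring
  have hX : Eul X = X * (1 + A - B) := by
    have : 1 + A - B = 1 + Eul U1 := by simp only [A]; ring
    rw [this]; exact Eul_wexp v1 h1
  have hY : Eul Y = Y * (1 + 2 * B) := by
    rw [← hBU]; exact Eul_wexp v2 h2
  have tB : Tendsto B.1 (Bornology.cobounded ℂ) (𝓝 (b : ℂ)) := by
    have := t2.const_mul (1 / 2 : ℂ)
    rw [show (1 / 2 : ℂ) * ((2 * b : ℝ) : ℂ) = b by push_cast; ring] at this
    exact this
  have tA : Tendsto A.1 (Bornology.cobounded ℂ) (𝓝 (a : ℂ)) := by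
    have := t1.add tB
    rw [show ((a - b : ℝ) : ℂ) + b = a by push_cast; ring] at this
    exact this
  have bA := Bd.of_tendsto tA
  have bB := Bd.of_tendsto tB
  have step : ∀ {f g h : Sm}, Bd f → Bd g → Bd h → Dbar (Eul f) = X * g + Y * h →
      Tendsto (Eul f).1 (Bornology.cobounded ℂ) (𝓝 0) := fun hf hg hh he =>
    tendsto_Eul_zero i1 i2 d1 d2 hf hg hh he
  have b0 : Bd 0 := by exact_mod_cast Bd.natCast 0
  have b2 : Bd 2 := by exact_mod_cast Bd.natCast 2
  have b3 : Bd 3 := by exact_mod_cast Bd.natCast 3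
  have k2 : Eul (2 : Sm) = 0 := by exact_mod_cast Eul.map_natCast 2
  have bM : Bd (1 + A - B) := (Bd.one.add bA).sub bB
  have bN : Bd (1 + 2 * B) := Bd.one.add (b2.mul bB)
  have tDA : Tendsto (Eul A).1 (Bornology.cobounded ℂ) (𝓝 0) :=
    step (g := -(1 + A - B)) (h := 0) bA bM.neg b0 <| by
      rw [Dbar_Eul, hA, map_neg, hX]; ring
  have tDB : Tendsto (Eul B).1 (Bornology.cobounded ℂ) (𝓝 0) :=
    step (g := 1 + A - B) (h := -(1 + 2 * B)) bB bM bN.neg <| by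
      rw [Dbar_Eul, hB, map_sub, hX, hY]; ring
  have bDA := Bd.of_tendsto tDA
  have bDB := Bd.of_tendsto tDB
  have bDM : Bd (Eul A - Eul B) := bDA.sub bDB
  have tDDA : Tendsto (Eul (Eul A)).1 (Bornology.cobounded ℂ) (𝓝 0) :=
    step (g := -((1 + A - B) * (1 + A - B) + (Eul A - Eul B))) (h := 0) bDA
      ((bM.mul bM).add bDM).neg b0 <| by
        rw [Dbar_Eul, Dbar_Eul, hA, map_neg, hX]
        simp only [map_neg, map_add, map_sub, Derivation.leibniz, Derivation.map_one_eq_zero, hX,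
          smul_eq_mul]
        ring
  have tDDB : Tendsto (Eul (Eul B)).1 (Bornology.cobounded ℂ) (𝓝 0) :=
    step (g := (1 + A - B) * (1 + A - B) + (Eul A - Eul B))
      (h := -((1 + 2 * B) * (1 + 2 * B) + 2 * Eul B)) bDB
      ((bM.mul bM).add bDM) ((bN.mul bN).add (b2.mul bDB)).neg <| by
        rw [Dbar_Eul, Dbar_Eul, hB, map_sub, hX, hY]
        simp only [map_add, map_sub, Derivation.leibniz, Derivation.map_one_eq_zero, hX,
          hY, k2, smul_eq_mul]
        ring
  have bDDA := Bd.of_tendsto tDDA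
  have bDDB := Bd.of_tendsto tDDB
  have tDDDA : Tendsto (Eul (Eul (Eul A))).1 (Bornology.cobounded ℂ) (𝓝 0) :=
    step (g := -((1 + A - B) * (1 + A - B) * (1 + A - B) + 3 * (1 + A - B) * (Eul A - Eul B) +
        (Eul (Eul A) - Eul (Eul B)))) (h := 0) bDDA
      ((((bM.mul bM).mul bM).add ((b3.mul bM).mul bDM)).add (bDDA.sub bDDB)).neg b0 <| by
        rw [Dbar_Eul, Dbar_Eul, Dbar_Eul, hA, map_neg, hX]
        simp only [map_neg, map_add, map_sub, Derivation.leibniz, Derivation.map_one_eq_zero, hX,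
          map_zero, smul_eq_mul]
        ring
  have vA : A.1 0 = 0 := by
    change 0 * _ + (1 / 2 : ℂ) * (0 * _) = 0
    ring
  have vB : B.1 0 = 0 := by
    change (1 / 2 : ℂ) * (0 * _) = 0
    ring
  have vE : ∀ f, (Eul f).1 0 = 0 := fun f => by rw [Eul_apply, zero_mul]
  -- the quadratic relation
  have hΩ : 3 * (Eul A - A) - A * A + (Eul B - B) - B * B = 0 := by
    refine eq_zero_of_Dbar_eq_zero (quadratic_invariant Eul Dbar Dbar_Eul hA hB hX hY)
      ((((b3.mul (bDA.sub bA)).sub (bA.mul bA)).add (bDB.sub bB)).sub (bB.mul bB)) ?_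
    change 3 * ((Eul A).1 0 - A.1 0) - A.1 0 * A.1 0 + ((Eul B).1 0 - B.1 0) - B.1 0 * B.1 0 = 0
    rw [vE, vE, vA, vB]; ring
  have hq : 3 * a + a ^ 2 + b + b ^ 2 = 0 := by
    have t := ((((tDA.sub tA).const_mul 3).sub (tA.mul tA)).add (tDB.sub tB)).sub (tB.mul tB)
    have t0 : Tendsto (fun _ : ℂ => (0 : ℂ)) (Bornology.cobounded ℂ) (𝓝 _) :=
      t.congr fun z => congrFun (congrArg Subtype.val hΩ) z
    have := tendsto_nhds_unique t0 tendsto_const_nhds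
    have h : (3 * a + a ^ 2 + b + b ^ 2 : ℂ) = 0 := by linear_combination -this
    exact_mod_cast h
  -- the quartic relation
  let P1 : Sm := Eul A - A - A * A
  let P2 : Sm := Eul P1 - 2 * P1 - A * P1
  let P3 : Sm := Eul P2 - 3 * P2 - A * P2
  have tP1 := (tDA.sub tA).sub (tA.mul tA)
  have tDP1 : Tendsto (Eul P1).1 (Bornology.cobounded ℂ) (𝓝 0) := by
    have e : Eul P1 = Eul (Eul A) - Eul A - 2 * A * Eul A := by
      simp only [P1, map_sub, Derivation.leibniz, smul_eq_mul]; ring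
    rw [e]
    have := (tDDA.sub tDA).sub ((tA.const_mul 2).mul tDA)
    simp only [mul_zero, sub_zero] at this
    exact this
  have tDDP1 : Tendsto (Eul (Eul P1)).1 (Bornology.cobounded ℂ) (𝓝 0) := by
    have e : Eul (Eul P1) = Eul (Eul (Eul A)) - Eul (Eul A) - 2 * Eul A * Eul A
        - 2 * A * Eul (Eul A) := by
      simp only [P1, map_sub, map_add, Derivation.leibniz, smul_eq_mul]; ring
    rw [e]
    have := ((tDDDA.sub tDDA).sub ((tDA.const_mul 2).mul tDA)).sub ((tA.const_mul 2).mul tDDA)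
    simp only [mul_zero, sub_zero] at this
    exact this
  have tP2 := (tDP1.sub (tP1.const_mul 2)).sub (tA.mul tP1)
  have tDP2 : Tendsto (Eul P2).1 (Bornology.cobounded ℂ) (𝓝 0) := by
    have e : Eul P2 = Eul (Eul P1) - 2 * Eul P1 - (A * Eul P1 + P1 * Eul A) := by
      simp only [P2, map_sub, Derivation.leibniz, smul_eq_mul, k2]; ring
    rw [e]
    have := (tDDP1.sub (tDP1.const_mul 2)).sub ((tA.mul tDP1).add (tP1.mul tDA))
    simp only [mul_zero, sub_zero, add_zero] at this
    exact this
  have tP3 := (tDP2.sub (tP2.const_mul 3)).sub (tA.mul tP2)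
  have hP3 : P3 = 0 := by
    refine eq_zero_of_Dbar_eq_zero (quartic_invariant Eul Dbar Dbar_Eul hA hX rfl rfl rfl hΩ)
      (Bd.of_tendsto (f := P3) tP3) ?_
    have w1 : P1.1 0 = 0 := by
      change (Eul A).1 0 - A.1 0 - A.1 0 * A.1 0 = 0
      rw [vE, vA]; ring
    have w2 : P2.1 0 = 0 := by
      change (Eul P1).1 0 - 2 * P1.1 0 - A.1 0 * P1.1 0 = 0
      rw [vE, w1]; ring
    change (Eul P2).1 0 - 3 * P2.1 0 - A.1 0 * P2.1 0 = 0
    rw [vE, w2]; ring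
  have h4 : a * (a + 1) * (a + 2) * (a + 3) = 0 := by
    have t0 : Tendsto (fun _ : ℂ => (0 : ℂ)) (Bornology.cobounded ℂ) (𝓝 _) :=
      tP3.congr fun z => congrFun (congrArg Subtype.val hP3) z
    have := tendsto_nhds_unique t0 tendsto_const_nhds
    have h : (a * (a + 1) * (a + 2) * (a + 3) : ℂ) = 0 := by linear_combination -this
    exact_mod_cast h
  obtain ⟨ha3, hb1⟩ := energy_of_relations ha0 r1 r2 hq h4
  have hI1 : I1 = 12 * π := by
    rw [ha] at ha3
    field_simp at ha3
    linarith
  refine ⟨hI1, ?_⟩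
  rw [hb, hI1] at hb1
  field_simp at hb1
  linarith

/-- The isometric identification of `ℂ` with the Euclidean plane. -/
def planeEquiv : ℂ ≃ₗᵢ[ℝ] E2 := Complex.orthonormalBasisOneI.repr

theorem planeEquiv_one : planeEquiv 1 = EuclideanSpace.single 0 1 := by
  simpa [planeEquiv] using Complex.orthonormalBasisOneI.repr_self 0

theorem planeEquiv_I : planeEquiv Complex.I = EuclideanSpace.single 1 1 := by
  simpa [planeEquiv] using Complex.orthonormalBasisOneI.repr_self 1

theorem fderiv_comp_planeEquiv (f : E2 → ℝ) (z w : ℂ) :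
    fderiv ℝ (fun y => f (planeEquiv y)) z w = fderiv ℝ f (planeEquiv z) (planeEquiv w) := by
  have h := planeEquiv.toContinuousLinearEquiv.comp_right_fderiv (f := f) (x := z)
  exact congrArg (fun L : ℂ →L[ℝ] ℝ => L w) h

theorem lapC_comp_planeEquiv (u : E2 → ℝ) (z : ℂ) :
    lapC (fun y => u (planeEquiv y)) z = lap u (planeEquiv z) := by
  simp only [lapC, lap, Fin.sum_univ_two, fderiv_comp_planeEquiv, planeEquiv_one, planeEquiv_I]
  rw [fderiv_comp_planeEquiv (fun y => fderiv ℝ u y (EuclideanSpace.single 0 1)),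
    fderiv_comp_planeEquiv (fun y => fderiv ℝ u y (EuclideanSpace.single 1 1)),
    planeEquiv_one, planeEquiv_I]

theorem integrable_comp_planeEquiv {f : E2 → ℝ} (hf : Integrable f) :
    Integrable fun z => f (planeEquiv z) :=
  (planeEquiv.measurePreserving.integrable_comp_emb
    planeEquiv.toHomeomorph.measurableEmbedding).2 hf

theorem integral_comp_planeEquiv (f : E2 → ℝ) : ∫ z, f (planeEquiv z) = ∫ x, f x :=
  planeEquiv.measurePreserving.integral_comp planeEquiv.toHomeomorph.measurableEmbedding f

end TodaB2

/-- Any finite-energy global solution of the `B₂` Toda system has energies `(6, 8)`. -/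
theorem b2_global_energy
    (u1 u2 : E2 → ℝ)
    (hu1 : ContDiff ℝ 2 u1) (hu2 : ContDiff ℝ 2 u2)
    (hpde1 : ∀ x : E2, lap u1 x + 2 * exp (u1 x) - exp (u2 x) = 0)
    (hpde2 : ∀ x : E2, lap u2 x - 2 * exp (u1 x) + 2 * exp (u2 x) = 0)
    (hint1 : Integrable (fun x : E2 => exp (u1 x)))
    (hint2 : Integrable (fun x : E2 => exp (u2 x))) :
    (1 / (2 * π)) * (∫ x : E2, exp (u1 x)) = 6 ∧
    (1 / (2 * π)) * (∫ x : E2, exp (u2 x)) = 8 := by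
  have hp : ContDiff ℝ 2 TodaB2.planeEquiv := TodaB2.planeEquiv.contDiff
  have h := TodaB2.energy_plane (hu1.comp hp) (hu2.comp hp)
    (fun z => (TodaB2.lapC_comp_planeEquiv u1 z).trans (by
      simp only [Function.comp_apply]; linarith [hpde1 (TodaB2.planeEquiv z)]))
    (fun z => (TodaB2.lapC_comp_planeEquiv u2 z).trans (by
      simp only [Function.comp_apply]; linarith [hpde2 (TodaB2.planeEquiv z)]))
    (TodaB2.integrable_comp_planeEquiv hint1) (TodaB2.integrable_comp_planeEquiv hint2)
  have h1 : ∫ x, exp (u1 x) = 12 * π :=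
    (TodaB2.integral_comp_planeEquiv fun x => exp (u1 x)).symm.trans h.1
  have h2 : ∫ x, exp (u2 x) = 16 * π :=
    (TodaB2.integral_comp_planeEquiv fun x => exp (u2 x)).symm.trans h.2
  rw [h1, h2]
  constructor <;> field_simp <;> norm_num
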